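/- Two (possibly non-unital) C*-algebras A and B are strongly Morita equivalent if and only if their Pedersen ideals P_A and P_B are formally Morita equivalent as *-algebras over ℂ. In particular, two unital C*-algebras are strongly Morita equivalent if and only if they are formally Morita equivalent. -/

import Mathlib

open scoped ComplexInnerProductSpace ComplexOrder

/-- A *-representation of a (possibly non-unital) *-algebra `A` over `ℂ` on a complex
inner product space (pre-Hilbert space, not assumed complete). -/
structure StarRep (A : Type) [NonUnitalRing A] [Module ℂ A] [Star A] : Type 1 where
  carrier : Type
  [nacg : NormedAddCommGroup carrier]
  [ips : InnerProductSpace ℂ carrier]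
  toFun : A → carrier →ₗ[ℂ] carrier
  map_add' : ∀ a b : A, toFun (a + b) = toFun a + toFun b
  map_smul' : ∀ (c : ℂ) (a : A), toFun (c • a) = c • toFun a
  map_mul' : ∀ a b : A, toFun (a * b) = toFun a ∘ₗ toFun b
  star_rep' : ∀ (a : A) (x y : carrier), ⟪toFun a x, y⟫ = ⟪x, toFun (star a) y⟫

attribute [instance] StarRep.nacg StarRep.ips


/-- A `(B,A)`-equivalence bimodule between *-algebras over `ℂ`: a `(B,A)`-bimodule with
full, positive, compatible `A`- and `B`-valued inner products satisfying properties P and Q. -/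
structure EquivBimodule (B A : Type)
    [NonUnitalRing A] [Module ℂ A] [SMulCommClass ℂ A A] [IsScalarTower ℂ A A]
    [StarRing A] [StarModule ℂ A]
    [NonUnitalRing B] [Module ℂ B] [SMulCommClass ℂ B B] [IsScalarTower ℂ B B]
    [StarRing B] [StarModule ℂ B] : Type 1 where
  X : Type
  [xgrp : AddCommGroup X]
  [xmod : Module ℂ X]
  lsmul : B → X → X
  rsmul : X → A → X
  lsmul_add : ∀ (b : B) (x y : X), lsmul b (x + y) = lsmul b x + lsmul b y
  add_lsmul : ∀ (b b' : B) (x : X), lsmul (b + b') x = lsmul b x + lsmul b' x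
  lsmul_smul : ∀ (c : ℂ) (b : B) (x : X), lsmul (c • b) x = c • lsmul b x
  smul_lsmul : ∀ (c : ℂ) (b : B) (x : X), lsmul b (c • x) = c • lsmul b x
  lsmul_mul : ∀ (b b' : B) (x : X), lsmul (b * b') x = lsmul b (lsmul b' x)
  rsmul_add : ∀ (x y : X) (a : A), rsmul (x + y) a = rsmul x a + rsmul y a
  add_rsmul : ∀ (x : X) (a a' : A), rsmul x (a + a') = rsmul x a + rsmul x a'
  rsmul_smul : ∀ (c : ℂ) (x : X) (a : A), rsmul (c • x) a = c • rsmul x a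
  smul_rsmul : ∀ (c : ℂ) (x : X) (a : A), rsmul x (c • a) = c • rsmul x a
  rsmul_mul : ∀ (x : X) (a a' : A), rsmul x (a * a') = rsmul (rsmul x a) a'
  lsmul_rsmul : ∀ (b : B) (x : X) (a : A), rsmul (lsmul b x) a = lsmul b (rsmul x a)
  ipA : X → X → A
  ipA_add : ∀ x y z : X, ipA x (y + z) = ipA x y + ipA x z
  ipA_smul : ∀ (c : ℂ) (x y : X), ipA x (c • y) = c • ipA x y
  ipA_rsmul : ∀ (x y : X) (a : A), ipA x (rsmul y a) = ipA x y * a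
  ipA_star : ∀ x y : X, ipA x y = star (ipA y x)
  ipA_compat : ∀ (b : B) (x y : X), ipA (lsmul b x) y = ipA x (lsmul (star b) y)
  ipB : X → X → B
  ipB_add : ∀ x y z : X, ipB (x + y) z = ipB x z + ipB y z
  ipB_smul : ∀ (c : ℂ) (x y : X), ipB (c • x) y = c • ipB x y
  ipB_lsmul : ∀ (b : B) (x y : X), ipB (lsmul b x) y = b * ipB x y
  ipB_star : ∀ x y : X, ipB x y = star (ipB y x)
  ipB_compat : ∀ (x y : X) (a : A), ipB (rsmul x a) y = ipB x (rsmul y (star a))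
  ip_compat : ∀ x y z : X, rsmul x (ipA y z) = lsmul (ipB x y) z
  fullA : Submodule.span ℂ {c : A | ∃ x y : X, c = ipA x y} = ⊤
  fullB : Submodule.span ℂ {c : B | ∃ x y : X, c = ipB x y} = ⊤
  posA : ∀ (ω : A →ₗ[ℂ] ℂ), (∀ a : A, 0 ≤ ω (star a * a)) → ∀ x : X, 0 ≤ ω (ipA x x)
  posB : ∀ (ω : B →ₗ[ℂ] ℂ), (∀ b : B, 0 ≤ ω (star b * b)) → ∀ x : X, 0 ≤ ω (ipB x x)
  propP : ∀ (R : StarRep A) (n : ℕ) (x : Fin n → X) (φ : Fin n → R.carrier),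
    0 ≤ ∑ i, ∑ j, ⟪φ i, R.toFun (ipA (x i) (x j)) (φ j)⟫
  propQ : ∀ (S : StarRep B) (n : ℕ) (x : Fin n → X) (ψ : Fin n → S.carrier),
    0 ≤ ∑ i, ∑ j, ⟪ψ i, S.toFun (ipB (x i) (x j)) (ψ j)⟫

/-- An imprimitivity `(B,A)`-bimodule between (possibly non-unital) C*-algebras: a
`(B,A)`-bimodule with positive-definite, topologically full, compatible `A`- and `B`-valued
inner products, complete in the norm `‖x‖ = ‖⟨x,x⟩_A‖^{1/2}`.  Its existence is strong Morita
equivalence of `A` and `B`. -/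
structure ImprimBimodule (B A : Type)
    [NonUnitalCStarAlgebra A] [PartialOrder A] [StarOrderedRing A]
    [NonUnitalCStarAlgebra B] [PartialOrder B] [StarOrderedRing B] : Type 1 where
  X : Type
  [xgrp : NormedAddCommGroup X]
  [xmod : Module ℂ X]
  [xcomplete : CompleteSpace X]
  lsmul : B → X → X
  rsmul : X → A → X
  lsmul_add : ∀ (b : B) (x y : X), lsmul b (x + y) = lsmul b x + lsmul b y
  add_lsmul : ∀ (b b' : B) (x : X), lsmul (b + b') x = lsmul b x + lsmul b' x
  lsmul_smul : ∀ (c : ℂ) (b : B) (x : X), lsmul (c • b) x = c • lsmul b x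
  smul_lsmul : ∀ (c : ℂ) (b : B) (x : X), lsmul b (c • x) = c • lsmul b x
  lsmul_mul : ∀ (b b' : B) (x : X), lsmul (b * b') x = lsmul b (lsmul b' x)
  rsmul_add : ∀ (x y : X) (a : A), rsmul (x + y) a = rsmul x a + rsmul y a
  add_rsmul : ∀ (x : X) (a a' : A), rsmul x (a + a') = rsmul x a + rsmul x a'
  rsmul_smul : ∀ (c : ℂ) (x : X) (a : A), rsmul (c • x) a = c • rsmul x a
  smul_rsmul : ∀ (c : ℂ) (x : X) (a : A), rsmul x (c • a) = c • rsmul x a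
  rsmul_mul : ∀ (x : X) (a a' : A), rsmul x (a * a') = rsmul (rsmul x a) a'
  lsmul_rsmul : ∀ (b : B) (x : X) (a : A), rsmul (lsmul b x) a = lsmul b (rsmul x a)
  ipA : X → X → A
  ipA_add : ∀ x y z : X, ipA x (y + z) = ipA x y + ipA x z
  ipA_smul : ∀ (c : ℂ) (x y : X), ipA x (c • y) = c • ipA x y
  ipA_rsmul : ∀ (x y : X) (a : A), ipA x (rsmul y a) = ipA x y * a
  ipA_star : ∀ x y : X, ipA x y = star (ipA y x)
  ipA_compat : ∀ (b : B) (x y : X), ipA (lsmul b x) y = ipA x (lsmul (star b) y)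
  ipB : X → X → B
  ipB_add : ∀ x y z : X, ipB (x + y) z = ipB x z + ipB y z
  ipB_smul : ∀ (c : ℂ) (x y : X), ipB (c • x) y = c • ipB x y
  ipB_lsmul : ∀ (b : B) (x y : X), ipB (lsmul b x) y = b * ipB x y
  ipB_star : ∀ x y : X, ipB x y = star (ipB y x)
  ipB_compat : ∀ (x y : X) (a : A), ipB (rsmul x a) y = ipB x (rsmul y (star a))
  ip_compat : ∀ x y z : X, rsmul x (ipA y z) = lsmul (ipB x y) z
  posA : ∀ x : X, 0 ≤ ipA x x
  posB : ∀ x : X, 0 ≤ ipB x x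
  defA : ∀ x : X, ipA x x = 0 → x = 0
  topFullA : Dense ((Submodule.span ℂ {c : A | ∃ x y : X, c = ipA x y} : Submodule ℂ A) : Set A)
  topFullB : Dense ((Submodule.span ℂ {c : B | ∃ x y : X, c = ipB x y} : Submodule ℂ B) : Set B)
  norm_eq : ∀ x : X, ‖x‖ = Real.sqrt ‖ipA x x‖

section CStarFacts

variable {A : Type} [NonUnitalCStarAlgebra A] [PartialOrder A] [StarOrderedRing A]

/-- A selfadjoint element on which all positive functionals are nonnegative is nonnegative. -/
theorem nonneg_of_forall_positive_functional {a : A} (ha : IsSelfAdjoint a)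
    (h : ∀ ω : A →ₗ[ℂ] ℂ, (∀ c : A, 0 ≤ ω (star c * c)) → 0 ≤ ω a) : 0 ≤ a := by
  by_contra hna
  let C : ProperCone ℝ A :=
    { toSubmodule :=
        { carrier := {x | 0 ≤ x}
          add_mem' := fun hx hy => add_nonneg hx hy
          zero_mem' := le_refl (0 : A)
          smul_mem' := fun c x hx => smul_nonneg c.2 hx }
      isClosed' := CStarAlgebra.isClosed_nonneg }
  have hmem : ∀ x, x ∈ C ↔ 0 ≤ x := fun x => Iff.rfl
  obtain ⟨f, hf, hf₀⟩ := C.hyperplane_separation_point (x₀ := a) (by rwa [hmem])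
  let ω : A →ₗ[ℂ] ℂ :=
    { toFun := fun x => (f (realPart x : A) : ℂ) + Complex.I * (f (imaginaryPart x : A) : ℂ)
      map_add' := fun x y => by simp; ring
      map_smul' := fun c x => by
        have h1 : ((realPart (c • x) : selfAdjoint A) : A)
            = c.re • (realPart x : A) - c.im • (imaginaryPart x : A) := by
          rw [realPart_smul]; simp
        have h2 : ((imaginaryPart (c • x) : selfAdjoint A) : A)
            = c.re • (imaginaryPart x : A) + c.im • (realPart x : A) := by
          rw [imaginaryPart_smul]; simp
        simp only [h1, h2, map_sub, map_add, map_smul, smul_eq_mul, RingHom.id_apply]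
        apply Complex.ext <;> simp }
  have hω : ∀ x : A, IsSelfAdjoint x → ω x = (f x : ℂ) := by
    intro x hx
    change (f (realPart x : A) : ℂ) + Complex.I * (f (imaginaryPart x : A) : ℂ) = _
    rw [hx.coe_realPart, hx.imaginaryPart]; simp
  have := h ω fun c => by
    rw [hω _ (.star_mul_self c)]
    exact_mod_cast hf _ (star_mul_self_nonneg c)
  rw [hω a ha] at this
  have h2 : 0 ≤ f a := by exact_mod_cast this
  exact absurd h2 (not_le.mpr hf₀)

omit [PartialOrder A] [StarOrderedRing A] in
/-- An algebraic stand-in for left multiplication by `(‖b‖² - star b * b) ^ (1 / 2)`. -/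
theorem exists_defect (b : A) : ∃ (r : ℂ) (d : A), ∀ s t : A,
    star (r • s + d * s) * (r • t + d * t) =
      (((‖b‖ ^ 2 : ℝ) : ℂ)) • (star s * t) - star (b * s) * (b * t) := by
  let u : Unitization ℂ A := algebraMap ℝ _ (‖b‖ ^ 2) - star (b : Unitization ℂ A) * b
  have hu : 0 ≤ u := by
    have := CStarAlgebra.star_mul_le_algebraMap_norm_sq (a := (b : Unitization ℂ A))
    rw [Unitization.norm_inr] at this
    exact sub_nonneg.mpr this
  obtain ⟨c, hc⟩ := CStarAlgebra.nonneg_iff_eq_star_mul_self.mp hu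
  refine ⟨c.fst, c.snd, fun s t => ?_⟩
  have key : ∀ s : A, c * (s : Unitization ℂ A) = ((c.fst • s + c.snd * s : A) : Unitization ℂ A) := by
    intro s
    ext <;> simp
  apply Unitization.inr_injective (R := ℂ)
  rw [Unitization.inr_mul, Unitization.inr_star, ← key, ← key, star_mul, mul_assoc,
    ← mul_assoc (star c) c, ← hc]
  simp only [u, sub_mul, mul_sub, Unitization.inr_sub, Unitization.inr_mul, Unitization.inr_star,
    Unitization.inr_smul, star_mul, mul_assoc]
  congr 1
  rw [← Unitization.inr_star, Algebra.algebraMap_eq_smul_one, smul_mul_assoc, one_mul, mul_smul_comm, ← Unitization.inr_mul]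
  rw [Complex.coe_smul]

theorem tendsto_star_mul_mul_approximateUnit {s : A} (hs : 0 ≤ s) :
    Filter.Tendsto (fun e => star e * s * e) (CStarAlgebra.approximateUnit A) (nhds s) := by
  obtain ⟨t, rfl⟩ := CStarAlgebra.nonneg_iff_eq_star_mul_self.mp hs
  have h := (CStarAlgebra.increasingApproximateUnit A).tendsto_mul_left t
  have h2 := h.star.mul h
  refine h2.congr fun e => ?_
  rw [star_mul, mul_assoc, mul_assoc, mul_assoc]

theorem IsClosed.mem_of_forall_mul_mem {T : Set A} (hT : IsClosed T) {a : A}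
    (h : ∀ e, a * e ∈ T) : a ∈ T :=
  hT.mem_of_tendsto ((CStarAlgebra.increasingApproximateUnit A).tendsto_mul_left a)
    (Filter.Eventually.of_forall h)

theorem IsClosed.mem_of_forall_mul_mem' {T : Set A} (hT : IsClosed T) {a : A}
    (h : ∀ e, e * a ∈ T) : a ∈ T :=
  hT.mem_of_tendsto ((CStarAlgebra.increasingApproximateUnit A).tendsto_mul_right a)
    (Filter.Eventually.of_forall h)

/-- A selfadjoint `M` is compressed by its negative part `N` to `-(R * N)⋆ (R * N)`, where
`R⋆ R = N`; it is positive as soon as `R * N` vanishes. -/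
theorem IsSelfAdjoint.exists_negative_compression {M : A} (hM : IsSelfAdjoint M) :
    ∃ N R : A, star N * M * N = -(star (R * N) * (R * N)) ∧
      (R * N = 0 → ∃ S, M = star S * S) := by
  have hN0 : 0 ≤ M⁻ := CFC.negPart_nonneg M
  have hNsa : star M⁻ = M⁻ := IsSelfAdjoint.of_nonneg hN0
  obtain ⟨R, hR⟩ := CStarAlgebra.nonneg_iff_eq_star_mul_self.mp hN0
  refine ⟨M⁻, R, ?_, fun h0 => ?_⟩
  · have h1 : star M⁻ * M = -(M⁻ * M⁻) := by
      rw [hNsa]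
      nth_rw 2 [← CFC.posPart_sub_negPart M hM]
      rw [mul_sub, CFC.negPart_mul_posPart, zero_sub]
    rw [h1, star_mul, hNsa, mul_assoc, ← mul_assoc (star R), ← hR, neg_mul, mul_assoc]
  · refine CStarAlgebra.nonneg_iff_eq_star_mul_self.mp ((CFC.negPart_eq_zero_iff M hM).mp ?_)
    have hNN : M⁻ * M⁻ = 0 := by
      nth_rw 1 [hR]
      rw [mul_assoc, h0, mul_zero]
    rw [← CStarRing.star_mul_self_eq_zero_iff, hNsa, hNN]

/-- A matrix over a C⋆-algebra whose quadratic form is nonnegative is of the form `star S * S`. -/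
theorem exists_eq_sum_star_mul {n : ℕ} (T : Fin n → Fin n → A)
    (hstar : ∀ i j, T i j = star (T j i))
    (hpos : ∀ v : Fin n → A, 0 ≤ ∑ i, ∑ j, star (v i) * T i j * v j) :
    ∃ S : Fin n → Fin n → A, ∀ i j, T i j = ∑ k, star (S k i) * S k j := by
  let M : CStarMatrix (Fin n) (Fin n) A := CStarMatrix.ofMatrix T
  have hM : IsSelfAdjoint M := by
    ext i j
    rw [CStarMatrix.star_apply]
    exact (hstar i j).symm
  obtain ⟨N, R, hMN, hS⟩ := hM.exists_negative_compression
  obtain ⟨S, hS⟩ := hS <| by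
    ext i k
    have h1 : 0 ≤ (star N * M * N) k k := by
      have := hpos fun i => N i k
      simp only [CStarMatrix.mul_apply, CStarMatrix.star_apply, Finset.sum_mul]
      rw [Finset.sum_comm]
      exact this
    rw [hMN] at h1
    have h2 : (star (R * N) * (R * N)) k k = ∑ i, star ((R * N) i k) * (R * N) i k := by
      rw [CStarMatrix.mul_apply]; rfl
    have h3 : ∑ i, star ((R * N) i k) * (R * N) i k = 0 := by
      refine le_antisymm ?_ (Finset.sum_nonneg fun i _ => star_mul_self_nonneg _)
      rw [← h2]
      simpa using h1
    rw [Finset.sum_eq_zero_iff_of_nonneg fun i _ => star_mul_self_nonneg _] at h3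
    exact CStarRing.star_mul_self_eq_zero_iff _ |>.mp (h3 i (Finset.mem_univ i))
  refine ⟨fun i j => S i j, fun i j => ?_⟩
  have : M i j = (star S * S) i j := by rw [← hS]
  rw [CStarMatrix.mul_apply] at this
  exact this

end CStarFacts

/-- The additive data shared by imprimitivity bimodules and equivalence bimodules of dense ideals:
two ideals `PB`, `PA` of C⋆-algebras acting on `X`, with compatible inner products that are
positive and topologically full. It is symmetric in `A` and `B`. -/
structure PreImprimBimodule {B A : Type}
    [NonUnitalCStarAlgebra A] [PartialOrder A] [NonUnitalCStarAlgebra B] [PartialOrder B]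
    (PB : NonUnitalStarSubalgebra ℂ B) (PA : NonUnitalStarSubalgebra ℂ A)
    (X : Type) [AddCommGroup X] where
  lsmul : PB → X → X
  rsmul : X → PA → X
  lsmul_add : ∀ (b : PB) (x y : X), lsmul b (x + y) = lsmul b x + lsmul b y
  rsmul_add : ∀ (x y : X) (a : PA), rsmul (x + y) a = rsmul x a + rsmul y a
  add_lsmul : ∀ (b b' : PB) (x : X), lsmul (b + b') x = lsmul b x + lsmul b' x
  add_rsmul : ∀ (x : X) (a a' : PA), rsmul x (a + a') = rsmul x a + rsmul x a'
  lsmul_mul : ∀ (b b' : PB) (x : X), lsmul (b * b') x = lsmul b (lsmul b' x)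
  rsmul_mul : ∀ (x : X) (a a' : PA), rsmul x (a * a') = rsmul (rsmul x a) a'
  ipA : X → X → PA
  ipB : X → X → PB
  ipA_add : ∀ x y z : X, ipA x (y + z) = ipA x y + ipA x z
  ipB_add : ∀ x y z : X, ipB (x + y) z = ipB x z + ipB y z
  ipA_rsmul : ∀ (x y : X) (a : PA), ipA x (rsmul y a) = ipA x y * a
  ipB_lsmul : ∀ (b : PB) (x y : X), ipB (lsmul b x) y = b * ipB x y
  ipA_star : ∀ x y : X, ipA x y = star (ipA y x)
  ipB_star : ∀ x y : X, ipB x y = star (ipB y x)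
  ipA_compat : ∀ (b : PB) (x y : X), ipA (lsmul b x) y = ipA x (lsmul (star b) y)
  ipB_compat : ∀ (x y : X) (a : PA), ipB (rsmul x a) y = ipB x (rsmul y (star a))
  ipA_smul_lsmul : ∀ (c : ℂ) (b : PB) (x y : X),
    ipA x (lsmul (c • b) y) = c • ipA x (lsmul b y)
  ipB_smul_rsmul : ∀ (c : ℂ) (a : PA) (x y : X),
    ipB (rsmul x (c • a)) y = c • ipB (rsmul x a) y
  ip_compat : ∀ x y z : X, rsmul x (ipA y z) = lsmul (ipB x y) z
  posA : ∀ x : X, 0 ≤ (ipA x x : A)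
  posB : ∀ x : X, 0 ≤ (ipB x x : B)
  fullA : Dense (AddSubgroup.closure {c : A | ∃ x y : X, c = ipA x y} : Set A)
  fullB : Dense (AddSubgroup.closure {c : B | ∃ x y : X, c = ipB x y} : Set B)
  mul_memA : ∀ (a : A) (p : PA), a * p ∈ PA
  mul_memB : ∀ (b : B) (p : PB), b * p ∈ PB

namespace PreImprimBimodule

variable {A B : Type}
  [NonUnitalCStarAlgebra A] [PartialOrder A] [NonUnitalCStarAlgebra B] [PartialOrder B]
  {PB : NonUnitalStarSubalgebra ℂ B} {PA : NonUnitalStarSubalgebra ℂ A}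
  {X : Type} [AddCommGroup X]

/-- The conjugate bimodule. -/
def symm (P : PreImprimBimodule PB PA X) : PreImprimBimodule PA PB X where
  lsmul a x := P.rsmul x (star a)
  rsmul x b := P.lsmul (star b) x
  lsmul_add b x y := P.rsmul_add x y _
  rsmul_add x y a := P.lsmul_add _ x y
  add_lsmul b b' x := by rw [star_add, P.add_rsmul]
  add_rsmul x a a' := by rw [star_add, P.add_lsmul]
  lsmul_mul b b' x := by rw [star_mul, P.rsmul_mul]
  rsmul_mul x a a' := by rw [star_mul, P.lsmul_mul]
  ipA := P.ipB
  ipB := P.ipA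
  ipA_add x y z := by
    rw [P.ipB_star, P.ipB_add, star_add, ← P.ipB_star, ← P.ipB_star]
  ipB_add x y z := by
    rw [P.ipA_star, P.ipA_add, star_add, ← P.ipA_star, ← P.ipA_star]
  ipA_rsmul x y a := by rw [P.ipB_star, P.ipB_lsmul, star_mul, star_star, ← P.ipB_star]
  ipB_lsmul b x y := by rw [P.ipA_star, P.ipA_rsmul, star_mul, star_star, ← P.ipA_star]
  ipA_star := P.ipB_star
  ipB_star := P.ipA_star
  ipA_compat b x y := by rw [P.ipB_compat]
  ipB_compat x y a := by rw [P.ipA_compat]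
  ipA_smul_lsmul c b x y := by
    rw [P.ipB_star, star_smul, P.ipB_smul_rsmul, star_smul, star_star, ← P.ipB_star]
  ipB_smul_rsmul c b x y := by
    rw [P.ipA_star, star_smul, P.ipA_smul_lsmul, star_smul, star_star, ← P.ipA_star]
  ip_compat x y z := by
    rw [← P.ipB_star, ← P.ipA_star, P.ip_compat]
  posA := P.posB
  posB := P.posA
  fullA := P.fullB
  fullB := P.fullA
  mul_memA := P.mul_memB
  mul_memB := P.mul_memA

variable (P : PreImprimBimodule PB PA X)

theorem ipA_add_left (x y z : X) : P.ipA (x + y) z = P.ipA x z + P.ipA y z :=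
  P.symm.ipB_add x y z

theorem ipA_rsmul_left (x y : X) (a : PA) : P.ipA (P.rsmul x a) y = star a * P.ipA x y := by
  rw [P.ipA_star, P.ipA_rsmul, star_mul, ← P.ipA_star]

theorem ipA_lsmul_lsmul (b b' : PB) (x y : X) :
    P.ipA (P.lsmul b x) (P.lsmul b' y) = P.ipA x (P.lsmul (star b * b') y) := by
  rw [P.ipA_compat, ← P.lsmul_mul]

theorem ipA_rsmul_rsmul (x y : X) (a a' : PA) :
    P.ipA (P.rsmul x a) (P.rsmul y a') = star a * P.ipA x y * a' := by
  rw [P.ipA_rsmul, P.ipA_rsmul_left]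

/-- `x ↦ b • x` as an additive map. -/
noncomputable def lsmulHom : PB →+ X →+ X :=
  AddMonoidHom.mk' (fun b => AddMonoidHom.mk' (P.lsmul b) (P.lsmul_add b))
    fun b b' => AddMonoidHom.ext (P.add_lsmul b b')

/-- The inner product `ipA` as a biadditive map. -/
noncomputable def ipAHom : X →+ X →+ PA :=
  AddMonoidHom.mk' (fun x => AddMonoidHom.mk' (P.ipA x) (P.ipA_add x))
    fun x y => AddMonoidHom.ext (P.ipA_add_left x y)

theorem lsmul_zero (b : PB) : P.lsmul b 0 = 0 := (P.lsmulHom b).map_zero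
theorem lsmul_neg (b : PB) (x : X) : P.lsmul b (-x) = -P.lsmul b x := (P.lsmulHom b).map_neg x
theorem zero_lsmul (x : X) : P.lsmul 0 x = 0 := DFunLike.congr_fun P.lsmulHom.map_zero x
theorem ipA_zero (x : X) : P.ipA x 0 = 0 := (P.ipAHom x).map_zero
theorem zero_ipA (x : X) : P.ipA 0 x = 0 := DFunLike.congr_fun P.ipAHom.map_zero x
theorem ipA_neg (x y : X) : P.ipA x (-y) = -P.ipA x y := (P.ipAHom x).map_neg y
theorem neg_ipA (x y : X) : P.ipA (-x) y = -P.ipA x y :=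
  DFunLike.congr_fun (P.ipAHom.map_neg x) y
theorem rsmul_zero (x : X) : P.rsmul x 0 = 0 := by simpa [symm] using P.symm.zero_lsmul x
theorem rsmul_neg (x : X) (a : PA) : P.rsmul x (-a) = -P.rsmul x a := by
  have := DFunLike.congr_fun (P.symm.lsmulHom.map_neg (star a)) x
  simpa [symm, lsmulHom] using this

theorem norm_ipA_rsmul_le (x : X) (a : PA) :
    ‖(P.ipA (P.rsmul x a) (P.rsmul x a) : A)‖ ≤ ‖(a : A)‖ ^ 2 * ‖(P.ipA x x : A)‖ := by
  rw [P.ipA_rsmul_rsmul]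
  have h1 := norm_mul_le (star (a : A) * (P.ipA x x : A)) a
  have h2 := norm_mul_le (star (a : A)) (P.ipA x x : A)
  rw [norm_star] at h2
  have h3 := mul_le_mul_of_nonneg_right h2 (norm_nonneg (a : A))
  calc _ ≤ _ := h1
    _ ≤ _ := h3
    _ = _ := by ring

variable [StarOrderedRing A]

theorem norm_ipA_sq_le (x y : X) :
    ‖(P.ipA x y : A)‖ ^ 2 ≤ ‖(P.ipA x x : A)‖ * ‖(P.ipA y y : A)‖ := by
  have key : ∀ ε : ℝ, 0 < ε →
      ‖(P.ipA x y : A)‖ ^ 2 ≤ (‖(P.ipA x x : A)‖ + ε) * ‖(P.ipA y y : A)‖ := by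
    intro ε hε
    set α := ‖(P.ipA x x : A)‖
    have hα : 0 ≤ α := norm_nonneg _
    set s : ℝ := (α + ε)⁻¹
    have hs : 0 < s := by positivity
    set t := P.ipA x y with ht
    have hpos := P.posA (y + P.rsmul x (((-s : ℝ) : ℂ) • t))
    have hyx : P.ipA y x = star t := P.ipA_star y x
    have expand : (P.ipA (y + P.rsmul x (((-s : ℝ) : ℂ) • t))
        (y + P.rsmul x (((-s : ℝ) : ℂ) • t)) : A) =
        P.ipA y y - (2 * s) • (star (t : A) * t) +
          (s ^ 2) • (star (t : A) * (P.ipA x x : A) * t) := by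
      rw [P.ipA_add, P.ipA_add_left, P.ipA_add_left, P.ipA_rsmul_rsmul, P.ipA_rsmul,
        P.ipA_rsmul_left, hyx, ← ht]
      have : ∀ z : A, ((-s : ℝ) : ℂ) • z = -(s • z) := fun z => by
        rw [Complex.coe_smul, neg_smul]
      have hstar : star ((-s : ℝ) : ℂ) = ((-s : ℝ) : ℂ) := Complex.conj_ofReal _
      simp only [NonUnitalStarSubalgebra.coe_add, NonUnitalStarSubalgebra.coe_mul,
        NonUnitalStarSubalgebra.coe_smul, StarMemClass.coe_star, this, hstar, star_smul,
        smul_mul_assoc, mul_smul_comm, smul_smul]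
      module
    rw [expand] at hpos
    have h1 : star (t : A) * (P.ipA x x : A) * t ≤ α • (star (t : A) * t) :=
      CStarAlgebra.star_left_conjugate_le_norm_smul (IsSelfAdjoint.of_nonneg (P.posA x))
    have h2 : s • (star (t : A) * t) ≤ P.ipA y y := by
      have h3 : (s ^ 2) • (star (t : A) * (P.ipA x x : A) * t) ≤
          (s ^ 2) • α • (star (t : A) * t) := smul_le_smul_of_nonneg_left h1 (by positivity)
      have h4 : (s ^ 2 * α) • (star (t : A) * t) ≤ s • (star (t : A) * t) := by
        refine smul_le_smul_of_nonneg_right ?_ (star_mul_self_nonneg _)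
        have : s * (α + ε) = 1 := inv_mul_cancel₀ (by positivity)
        nlinarith
      rw [smul_smul] at h3
      have h5 := hpos.trans (add_le_add_right (h3.trans h4) _)
      have : (P.ipA y y : A) - (2 * s) • (star (t : A) * t) + s • (star (t : A) * t) =
        P.ipA y y - s • (star (t : A) * t) := by module
      rw [this] at h5
      exact sub_nonneg.mp h5
    have h6 := CStarAlgebra.norm_le_norm_of_nonneg_of_le
      (smul_nonneg hs.le (star_mul_self_nonneg (t : A))) h2
    rw [norm_smul, CStarRing.norm_star_mul_self, Real.norm_of_nonneg hs.le, ← pow_two] at h6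
    have : s * (α + ε) = 1 := inv_mul_cancel₀ (by positivity)
    calc ‖(t : A)‖ ^ 2 = (s * (α + ε)) * ‖(t : A)‖ ^ 2 := by rw [this, one_mul]
      _ = (α + ε) * (s * ‖(t : A)‖ ^ 2) := by ring
      _ ≤ _ := by gcongr
  refine le_of_forall_pos_le_add fun δ hδ => ?_
  have hn := norm_nonneg (P.ipA y y : A)
  refine (key (δ / (‖(P.ipA y y : A)‖ + 1)) (by positivity)).trans ?_
  rw [add_mul]
  gcongr
  rw [div_mul_eq_mul_div, div_le_iff₀ (by positivity)]
  nlinarith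

/-- Left multiplication by `b` contracts on the span of `PB • X` by the factor `‖b‖`. -/
theorem ipA_lsmul_le {z : X}
    (hz : z ∈ AddSubgroup.closure {z | ∃ b y, z = P.lsmul b y}) (b : PB) :
    (P.ipA (P.lsmul b z) (P.lsmul b z) : A) ≤ (‖(b : B)‖ ^ 2) • (P.ipA z z : A) := by
  obtain ⟨r, d, hrd⟩ := exists_defect (b : B)
  let γ : PB → PB := fun p => r • p + ⟨d * p, P.mul_memB d p⟩
  have hγ : ∀ p q : PB, star (γ p) * γ q =
      (((‖(b : B)‖ ^ 2 : ℝ) : ℂ)) • (star p * q) - star (b * p) * (b * q) := fun p q =>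
    Subtype.ext (hrd p q)
  let S : AddSubgroup (X × X) :=
    AddSubgroup.closure {w | ∃ p y, w = (P.lsmul p y, P.lsmul (γ p) y)}
  have hS : ∀ v ∈ S, ∀ w ∈ S, P.ipA v.2 w.2 =
      (((‖(b : B)‖ ^ 2 : ℝ) : ℂ)) • P.ipA v.1 w.1 -
        P.ipA (P.lsmul b v.1) (P.lsmul b w.1) := by
    intro v hv w hw
    induction hv, hw using AddSubgroup.closure_induction₂ with
    | mem v w hv hw =>
      obtain ⟨p, y, rfl⟩ := hv
      obtain ⟨q, y', rfl⟩ := hw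
      simp only [← P.lsmul_mul]
      rw [P.ipA_lsmul_lsmul, hγ, P.ipA_lsmul_lsmul, P.ipA_lsmul_lsmul, ← P.ipA_smul_lsmul,
        sub_eq_add_neg, P.add_lsmul, P.ipA_add, sub_eq_add_neg]
      congr 1
      have := DFunLike.congr_fun (P.lsmulHom.map_neg (star (b * p) * (b * q))) y'
      change P.lsmul (-_) _ = -P.lsmul _ _ at this
      rw [this, P.ipA_neg]
    | zero_left w hw => simp [P.lsmul_zero, P.zero_ipA]
    | zero_right w hw => simp [P.lsmul_zero, P.ipA_zero]
    | add_left v v' w _ _ _ h h' =>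
      simp only [Prod.fst_add, Prod.snd_add, P.lsmul_add, P.ipA_add_left, h, h', smul_add]
      abel
    | add_right v v' w _ _ _ h h' =>
      simp only [Prod.fst_add, Prod.snd_add, P.lsmul_add, P.ipA_add, h, h', smul_add]
      abel
    | neg_left v w _ _ h =>
      simp only [Prod.fst_neg, Prod.snd_neg, P.lsmul_neg, P.neg_ipA, h, smul_neg]
      abel
    | neg_right v w _ _ h =>
      simp only [Prod.fst_neg, Prod.snd_neg, P.lsmul_neg, P.ipA_neg, h, smul_neg]
      abel
  obtain ⟨w, hw⟩ : ∃ w, (z, w) ∈ S := by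
    have : AddSubgroup.closure {z | ∃ b y, z = P.lsmul b y} ≤ S.map (AddMonoidHom.fst X X) := by
      rw [AddSubgroup.closure_le]
      rintro _ ⟨p, y, rfl⟩
      exact ⟨_, AddSubgroup.subset_closure ⟨p, y, rfl⟩, rfl⟩
    obtain ⟨⟨z', w⟩, hw, rfl⟩ := this hz
    exact ⟨w, hw⟩
  have h := P.posA w
  have h2 := congrArg (Subtype.val : PA → A) (hS _ hw _ hw)
  dsimp only at h2
  rw [h2] at h
  simpa [← Complex.coe_smul] using h

theorem norm_ipA_lsmul_le (b : PB) (x : X) :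
    ‖(P.ipA (P.lsmul b x) (P.lsmul b x) : A)‖ ≤ ‖(b : B)‖ ^ 2 * ‖(P.ipA x x : A)‖ := by
  let s : A := P.ipA x x
  let s' : A := P.ipA (P.lsmul b x) (P.lsmul b x)
  have hcl : ∀ e ∈ AddSubgroup.closure {c : A | ∃ x y : X, c = P.ipA x y},
      ∃ p : PA, (p : A) = e ∧
        P.rsmul x p ∈ AddSubgroup.closure {z | ∃ b y, z = P.lsmul b y} ∧
        P.lsmul b (P.rsmul x p) = P.rsmul (P.lsmul b x) p := by
    intro e he
    induction he using AddSubgroup.closure_induction with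
    | mem e he =>
      obtain ⟨y, z, rfl⟩ := he
      refine ⟨P.ipA y z, rfl, ?_, ?_⟩
      · rw [P.ip_compat]
        exact AddSubgroup.subset_closure ⟨_, _, rfl⟩
      · rw [P.ip_compat, P.ip_compat, P.ipB_lsmul, P.lsmul_mul]
    | zero => exact ⟨0, rfl, by rw [P.rsmul_zero]; exact zero_mem _, by
        rw [P.rsmul_zero, P.rsmul_zero, P.lsmul_zero]⟩
    | add e e' _ _ h h' =>
      obtain ⟨p, rfl, h1, h2⟩ := h
      obtain ⟨p', rfl, h1', h2'⟩ := h'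
      refine ⟨p + p', rfl, ?_, ?_⟩
      · rw [P.add_rsmul]; exact add_mem h1 h1'
      · rw [P.add_rsmul, P.add_rsmul, P.lsmul_add, h2, h2']
    | neg e _ h =>
      obtain ⟨p, rfl, h1, h2⟩ := h
      refine ⟨-p, rfl, ?_, ?_⟩
      · rw [P.rsmul_neg]; exact neg_mem h1
      · rw [P.rsmul_neg, P.rsmul_neg, P.lsmul_neg, h2]
  have h1 : ∀ e : A, star e * s' * e ≤ (‖(b : B)‖ ^ 2) • (star e * s * e) := by
    intro e
    refine isClosed_property (p := fun e : A => star e * s' * e ≤ (‖(b : B)‖ ^ 2) • (star e * s * e))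
      P.fullA.denseRange_val (isClosed_le (by fun_prop) (by fun_prop)) ?_ e
    rintro ⟨e, he⟩
    obtain ⟨p, rfl, hp, hp'⟩ := hcl e he
    have := P.ipA_lsmul_le hp b
    rw [hp', P.ipA_rsmul_rsmul, P.ipA_rsmul_rsmul] at this
    exact this
  have h2 : s' ≤ (‖(b : B)‖ ^ 2) • s :=
    le_of_tendsto_of_tendsto' (tendsto_star_mul_mul_approximateUnit (P.posA _))
      ((tendsto_star_mul_mul_approximateUnit (P.posA _)).const_smul _) h1
  have h3 := CStarAlgebra.norm_le_norm_of_nonneg_of_le (P.posA _) h2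
  rwa [norm_smul, Real.norm_of_nonneg (by positivity)] at h3

variable [StarOrderedRing B]

omit [StarOrderedRing A] in
theorem norm_ipB_le (x : X) : ‖(P.ipB x x : B)‖ ≤ ‖(P.ipA x x : A)‖ := by
  set b := P.ipB x x with hb
  set a := P.ipA x x with ha
  have h1 : b * b = P.ipB (P.rsmul x a) x := by
    rw [ha, P.ip_compat, P.ipB_lsmul]
  have hbs : star b = b := (P.ipB_star x x).symm
  have h2 := P.symm.norm_ipA_sq_le (P.rsmul x a) x
  have h3 := P.symm.norm_ipA_lsmul_le (star a) x
  simp only [symm, star_star] at h2 h3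
  rw [← h1, ← hb] at h2
  rw [← hb] at h3
  have h4 : ‖((b * b : PB) : B)‖ = ‖(b : B)‖ ^ 2 := by
    have : b * b = star b * b := by rw [hbs]
    rw [this, NonUnitalStarSubalgebra.coe_mul, StarMemClass.coe_star,
      CStarRing.norm_star_mul_self, pow_two]
  rw [h4] at h2
  rw [StarMemClass.coe_star, norm_star] at h3
  have hβ := norm_nonneg (b : B)
  have hα := norm_nonneg (a : A)
  by_contra! hlt
  have hβ' : 0 < ‖(b : B)‖ := hα.trans_lt hlt
  have h5 : (‖(b : B)‖ ^ 2) ^ 2 ≤ ‖(a : A)‖ ^ 2 * ‖(b : B)‖ * ‖(b : B)‖ :=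
    h2.trans (mul_le_mul_of_nonneg_right h3 hβ)
  have h6 : ‖(a : A)‖ ^ 2 < ‖(b : B)‖ ^ 2 := by gcongr
  nlinarith [mul_lt_mul_of_pos_right h6 (show 0 < ‖(b : B)‖ ^ 2 by positivity)]

theorem norm_ipB_eq (x : X) : ‖(P.ipB x x : B)‖ = ‖(P.ipA x x : A)‖ :=
  le_antisymm (P.norm_ipB_le x) (P.symm.norm_ipB_le x)

end PreImprimBimodule

theorem exists_eq_sum_star_mul_of_fintype {A : Type} [NonUnitalCStarAlgebra A] [PartialOrder A]
    [StarOrderedRing A] {ι : Type} [Fintype ι] (T : ι → ι → A)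
    (hstar : ∀ i j, T i j = star (T j i))
    (hpos : ∀ v : ι → A, 0 ≤ ∑ i, ∑ j, star (v i) * T i j * v j) :
    ∃ (n : ℕ) (S : Fin n → ι → A), ∀ i j, T i j = ∑ k, star (S k i) * S k j := by
  let e := Fintype.equivFin ι
  obtain ⟨S, hS⟩ := exists_eq_sum_star_mul (fun i j => T (e.symm i) (e.symm j))
    (fun i j => hstar _ _) (fun v => by
      have h : ∑ i, ∑ j, star (v i) * T (e.symm i) (e.symm j) * v j =
          ∑ i, ∑ j, star (v (e i)) * T i j * v (e j) := by
        rw [← e.sum_comp]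
        refine Finset.sum_congr rfl fun i _ => ?_
        rw [← e.sum_comp]
        simp
      rw [h]
      exact hpos _)
  exact ⟨_, fun k i => S k (e i), fun i j => by rw [← hS]; simp⟩

namespace PreImprimBimodule

variable {A B : Type}
  [NonUnitalCStarAlgebra A] [PartialOrder A] [NonUnitalCStarAlgebra B] [PartialOrder B]

theorem symm_symm {PB : NonUnitalStarSubalgebra ℂ B} {PA : NonUnitalStarSubalgebra ℂ A}
    {X : Type} [AddCommGroup X] (P : PreImprimBimodule PB PA X) : P.symm.symm = P := by
  cases P
  simp [symm]

variable {X : Type} [AddCommGroup X]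
  (P : PreImprimBimodule (⊤ : NonUnitalStarSubalgebra ℂ B) (⊤ : NonUnitalStarSubalgebra ℂ A) X)
  {PA : NonUnitalStarSubalgebra ℂ A} {PB : NonUnitalStarSubalgebra ℂ B}

/-- The additive span of `X • PA`. -/
def rightSpan (PA : NonUnitalStarSubalgebra ℂ A) : AddSubgroup X :=
  AddSubgroup.closure {z | ∃ x, ∃ p ∈ PA, z = P.rsmul x ⟨p, NonUnitalStarAlgebra.mem_top⟩}

theorem rsmul_mem_rightSpan (x : X) {a : (⊤ : NonUnitalStarSubalgebra ℂ A)} (ha : (a : A) ∈ PA) :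
    P.rsmul x a ∈ P.rightSpan PA :=
  AddSubgroup.subset_closure ⟨x, a, ha, rfl⟩

theorem lsmul_mem_symm_rightSpan (x : X) {b : (⊤ : NonUnitalStarSubalgebra ℂ B)}
    (hb : (b : B) ∈ PB) : P.lsmul b x ∈ P.symm.rightSpan PB := by
  have := P.symm.rsmul_mem_rightSpan (PA := PB) x (a := star b) (star_mem hb)
  simpa [symm] using this

theorem rsmul_mem_of_mem_rightSpan (hPA : ∀ a ∈ PA, ∀ b : A, a * b ∈ PA ∧ b * a ∈ PA) {x : X}
    (hx : x ∈ P.rightSpan PA) (a : (⊤ : NonUnitalStarSubalgebra ℂ A)) :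
    P.rsmul x a ∈ P.rightSpan PA := by
  induction hx using AddSubgroup.closure_induction with
  | mem x hx =>
    obtain ⟨x, p, hp, rfl⟩ := hx
    rw [← P.rsmul_mul]
    exact P.rsmul_mem_rightSpan x (hPA p hp a).1
  | zero =>
    have := P.symm.lsmul_zero (star a)
    simp only [symm, star_star] at this
    rw [this]
    exact zero_mem _
  | add x y _ _ h h' => rw [P.rsmul_add]; exact add_mem h h'
  | neg x _ h =>
    have := P.symm.lsmul_neg (star a) x
    simp only [symm, star_star] at this
    rw [this]
    exact neg_mem h

theorem ipA_mem_of_mem_rightSpan (hPA : ∀ a ∈ PA, ∀ b : A, a * b ∈ PA ∧ b * a ∈ PA) (x : X) {y : X}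
    (hy : y ∈ P.rightSpan PA) : (P.ipA x y : A) ∈ PA := by
  induction hy using AddSubgroup.closure_induction with
  | mem y hy =>
    obtain ⟨y, p, hp, rfl⟩ := hy
    rw [P.ipA_rsmul]
    exact (hPA p hp _).2
  | zero => rw [P.ipA_zero]; exact zero_mem _
  | add y z _ _ h h' => rw [P.ipA_add]; exact add_mem h h'
  | neg y _ h => rw [P.ipA_neg]; exact neg_mem h

theorem exists_eq_sum_rsmul_of_mem_rightSpan {x : X} (hx : x ∈ P.rightSpan PA) :
    ∃ (ι : Type) (_ : Fintype ι) (z : ι → X) (p : ι → (⊤ : NonUnitalStarSubalgebra ℂ A)),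
      (∀ i, (p i : A) ∈ PA) ∧ x = ∑ i, P.rsmul (z i) (p i) := by
  induction hx using AddSubgroup.closure_induction with
  | mem x hx =>
    obtain ⟨x, p, hp, rfl⟩ := hx
    exact ⟨Unit, inferInstance, fun _ => x, fun _ => ⟨p, NonUnitalStarAlgebra.mem_top⟩, fun _ => hp, by simp⟩
  | zero => exact ⟨Empty, inferInstance, nofun, nofun, nofun, by simp⟩
  | add x y _ _ h h' =>
    obtain ⟨ι, _, z, p, hp, rfl⟩ := h
    obtain ⟨ι', _, z', p', hp', rfl⟩ := h'
    exact ⟨ι ⊕ ι', inferInstance, Sum.elim z z', Sum.elim p p',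
      by rintro (i | i) <;> simp [hp, hp'], by simp⟩
  | neg x _ h =>
    obtain ⟨ι, _, z, p, hp, rfl⟩ := h
    exact ⟨ι, inferInstance, z, fun i => -p i, fun i => neg_mem (hp i), by simp [P.rsmul_neg]⟩

theorem dense_of_forall_star_mul_ipA_mul_mem [StarOrderedRing A] (hPA : Dense (PA : Set A))
    (K : AddSubgroup A)
    (hK : ∀ x y, ∀ p ∈ PA, ∀ q ∈ PA, star p * (P.ipA x y : A) * q ∈ K) : Dense (K : Set A) := by
  let T := K.topologicalClosure
  have hT : IsClosed (T : Set A) := K.isClosed_topologicalClosure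
  have h1 : ∀ x y a c, a * (P.ipA x y : A) * c ∈ T := by
    intro x y a c
    refine isClosed_property2 (p := fun a c => a * (P.ipA x y : A) * c ∈ T) hPA.denseRange_val ?_ ?_ a c
    · exact hT.preimage (by fun_prop)
    · intro p q
      have := hK x y (star p) (star_mem p.2) q q.2
      rw [star_star] at this
      exact K.le_topologicalClosure this
  have h2 : ∀ t a c, a * t * c ∈ T := by
    intro t a c
    refine isClosed_property (p := fun t => a * t * c ∈ T) P.fullA.denseRange_val
      (hT.preimage (by fun_prop)) ?_ t
    rintro ⟨t, ht⟩
    induction ht using AddSubgroup.closure_induction with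
    | mem t ht => obtain ⟨x, y, rfl⟩ := ht; exact h1 x y a c
    | zero => simp
    | add t t' _ _ h h' => simpa [mul_add, add_mul] using add_mem h h'
    | neg t _ h => simpa using h
  have h3 : ∀ t, t ∈ T := fun t => hT.mem_of_forall_mul_mem fun e =>
    hT.mem_of_forall_mul_mem' fun e' => by
      have := h2 t e' e
      rwa [mul_assoc] at this
  exact fun t => h3 t

theorem coe_subset_closure_ipA [StarOrderedRing A] (hPAdense : Dense (PA : Set A))
    (hPAmin : ∀ I : TwoSidedIdeal A, Dense (I : Set A) → (PA : Set A) ⊆ (I : Set A))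
    (hPA : ∀ a ∈ PA, ∀ b : A, a * b ∈ PA ∧ b * a ∈ PA) :
    (PA : Set A) ⊆ AddSubgroup.closure
      {c : A | ∃ x ∈ P.rightSpan PA, ∃ y ∈ P.rightSpan PA, c = P.ipA x y} := by
  set K := AddSubgroup.closure
      {c : A | ∃ x ∈ P.rightSpan PA, ∃ y ∈ P.rightSpan PA, c = P.ipA x y} with hK
  let I : TwoSidedIdeal A := TwoSidedIdeal.mk' K (zero_mem _) add_mem neg_mem
    (fun {a c} hc => by
      change c ∈ K at hc
      change a * c ∈ K
      induction hc using AddSubgroup.closure_induction with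
      | mem t ht =>
        obtain ⟨x, hx, y, hy, rfl⟩ := ht
        refine AddSubgroup.subset_closure ⟨P.rsmul x (star ⟨a, NonUnitalStarAlgebra.mem_top⟩),
          P.rsmul_mem_of_mem_rightSpan hPA hx _, y, hy, ?_⟩
        rw [P.ipA_rsmul_left, star_star]
        rfl
      | zero => simp
      | add t t' _ _ h h' => rw [mul_add]; exact add_mem h h'
      | neg t _ h => rw [mul_neg]; exact neg_mem h)
    (fun {c a} hc => by
      change c ∈ K at hc
      change c * a ∈ K
      induction hc using AddSubgroup.closure_induction with
      | mem t ht =>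
        obtain ⟨x, hx, y, hy, rfl⟩ := ht
        refine AddSubgroup.subset_closure ⟨x, hx, P.rsmul y ⟨a, NonUnitalStarAlgebra.mem_top⟩,
          P.rsmul_mem_of_mem_rightSpan hPA hy _, ?_⟩
        rw [P.ipA_rsmul]
        rfl
      | zero => simp
      | add t t' _ _ h h' => rw [add_mul]; exact add_mem h h'
      | neg t _ h => rw [neg_mul]; exact neg_mem h)
  have hI : (I : Set A) = K := by
    ext a
    exact TwoSidedIdeal.mem_mk' ..
  rw [← hI]
  refine hPAmin I ?_
  rw [hI]
  refine P.dense_of_forall_star_mul_ipA_mul_mem hPAdense K fun x y p hp q hq => ?_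
  refine AddSubgroup.subset_closure ⟨P.rsmul x ⟨p, NonUnitalStarAlgebra.mem_top⟩, P.rsmul_mem_rightSpan x hp,
    P.rsmul y ⟨q, NonUnitalStarAlgebra.mem_top⟩, P.rsmul_mem_rightSpan y hq, ?_⟩
  rw [P.ipA_rsmul_rsmul]
  rfl

theorem lsmul_rsmul_ipA (b : (⊤ : NonUnitalStarSubalgebra ℂ B)) (x y : X)
    (a : (⊤ : NonUnitalStarSubalgebra ℂ A)) :
    P.ipA y (P.lsmul b x) * a = P.ipA y (P.lsmul b (P.rsmul x a)) := by
  have h : ∀ z, P.ipA y (P.lsmul b z) = P.ipA (P.lsmul (star b) y) z := fun z => by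
    rw [P.ipA_compat, star_star]
  rw [h, h, P.ipA_rsmul]

theorem continuous_ipA_lsmul [StarOrderedRing A] [StarOrderedRing B] (x y : X) :
    Continuous fun b : B => (P.ipA y (P.lsmul ⟨b, NonUnitalStarAlgebra.mem_top⟩ x) : A) := by
  let f : B →+ A := AddMonoidHom.mk' (fun b : B => (P.ipA y (P.lsmul ⟨b, NonUnitalStarAlgebra.mem_top⟩ x) : A))
    fun b b' => by
      rw [← NonUnitalStarSubalgebra.coe_add, ← P.ipA_add, ← P.add_lsmul]
      rfl
  refine AddMonoidHomClass.continuous_of_bound f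
    (Real.sqrt (‖(P.ipA y y : A)‖ * ‖(P.ipA x x : A)‖)) fun b => ?_
  have h1 := P.norm_ipA_sq_le y (P.lsmul ⟨b, NonUnitalStarAlgebra.mem_top⟩ x)
  have h2 := P.norm_ipA_lsmul_le ⟨b, NonUnitalStarAlgebra.mem_top⟩ x
  change ‖(P.ipA y (P.lsmul ⟨b, NonUnitalStarAlgebra.mem_top⟩ x) : A)‖ ≤ _
  refine le_of_sq_le_sq ?_ (by positivity)
  rw [mul_pow, Real.sq_sqrt (by positivity)]
  refine h1.trans ?_
  have := mul_le_mul_of_nonneg_left h2 (norm_nonneg (P.ipA y y : A))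
  calc _ ≤ _ := this
    _ = _ := by ring

theorem coe_subset_closure_ipA_lsmul [StarOrderedRing A] [StarOrderedRing B]
    (hPAmin : ∀ I : TwoSidedIdeal A, Dense (I : Set A) → (PA : Set A) ⊆ (I : Set A))
    (hPBdense : Dense (PB : Set B)) :
    (PA : Set A) ⊆ AddSubgroup.closure
      {c : A | ∃ x y, ∃ b ∈ PB, c = P.ipA y (P.lsmul ⟨b, NonUnitalStarAlgebra.mem_top⟩ x)} := by
  set K := AddSubgroup.closure
      {c : A | ∃ x y, ∃ b ∈ PB, c = P.ipA y (P.lsmul ⟨b, NonUnitalStarAlgebra.mem_top⟩ x)} with hK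
  let I : TwoSidedIdeal A := TwoSidedIdeal.mk' K (zero_mem _) add_mem neg_mem
    (fun {a c} hc => by
      change c ∈ K at hc
      change a * c ∈ K
      induction hc using AddSubgroup.closure_induction with
      | mem t ht =>
        obtain ⟨x, y, b, hb, rfl⟩ := ht
        refine AddSubgroup.subset_closure ⟨x, P.rsmul y (star ⟨a, NonUnitalStarAlgebra.mem_top⟩), b, hb, ?_⟩
        rw [P.ipA_rsmul_left, star_star]
        rfl
      | zero => simp
      | add t t' _ _ h h' => rw [mul_add]; exact add_mem h h'
      | neg t _ h => rw [mul_neg]; exact neg_mem h)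
    (fun {c a} hc => by
      change c ∈ K at hc
      change c * a ∈ K
      induction hc using AddSubgroup.closure_induction with
      | mem t ht =>
        obtain ⟨x, y, b, hb, rfl⟩ := ht
        refine AddSubgroup.subset_closure ⟨P.rsmul x ⟨a, NonUnitalStarAlgebra.mem_top⟩, y, b, hb, ?_⟩
        rw [← P.lsmul_rsmul_ipA]
        rfl
      | zero => simp
      | add t t' _ _ h h' => rw [add_mul]; exact add_mem h h'
      | neg t _ h => rw [neg_mul]; exact neg_mem h)
  have hI : (I : Set A) = K := by
    ext a
    exact TwoSidedIdeal.mem_mk' ..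
  rw [← hI]
  refine hPAmin I ?_
  rw [hI]
  let T := K.topologicalClosure
  have hT : IsClosed (T : Set A) := K.isClosed_topologicalClosure
  have h1 : ∀ x y b, (P.ipA y (P.lsmul ⟨b, NonUnitalStarAlgebra.mem_top⟩ x) : A) ∈ T := by
    intro x y b
    refine isClosed_property (p := fun b => (P.ipA y (P.lsmul ⟨b, NonUnitalStarAlgebra.mem_top⟩ x) : A) ∈ T)
      hPBdense.denseRange_val (hT.preimage (P.continuous_ipA_lsmul x y)) ?_ b
    exact fun b => K.le_topologicalClosure (AddSubgroup.subset_closure ⟨x, y, b, b.2, rfl⟩)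
  have h2 : ∀ x y u v, (P.ipA y u : A) * P.ipA v x ∈ T := by
    intro x y u v
    have := h1 x y (P.ipB u v)
    rw [Subtype.coe_eta, ← P.ip_compat, P.ipA_rsmul] at this
    exact this
  have h3 : ∀ a c, a * c ∈ T := by
    intro a c
    refine isClosed_property2 (p := fun a c => a * c ∈ T) P.fullA.denseRange_val
      (hT.preimage (by fun_prop)) ?_ a c
    rintro ⟨a, ha⟩ ⟨c, hc⟩
    dsimp only
    induction ha, hc using AddSubgroup.closure_induction₂ with
    | mem a c ha hc =>
      obtain ⟨y, u, rfl⟩ := ha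
      obtain ⟨v, x, rfl⟩ := hc
      exact h2 x y u v
    | zero_left => simp
    | zero_right => simp
    | add_left _ _ _ _ _ _ h h' => rw [add_mul]; exact add_mem h h'
    | add_right _ _ _ _ _ _ h h' => rw [mul_add]; exact add_mem h h'
    | neg_left _ _ _ _ h => rw [neg_mul]; exact neg_mem h
    | neg_right _ _ _ _ h => rw [mul_neg]; exact neg_mem h
  exact fun t => hT.mem_of_forall_mul_mem fun e => h3 t e

theorem rightSpan_le [StarOrderedRing A] [StarOrderedRing B]
    (hPAmin : ∀ I : TwoSidedIdeal A, Dense (I : Set A) → (PA : Set A) ⊆ (I : Set A))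
    (hPB : ∀ a ∈ PB, ∀ b : B, a * b ∈ PB ∧ b * a ∈ PB) (hPBdense : Dense (PB : Set B)) :
    P.rightSpan PA ≤ P.symm.rightSpan PB := by
  refine (AddSubgroup.closure_le _).2 ?_
  rintro _ ⟨x, p, hp, rfl⟩
  suffices ∀ c ∈ AddSubgroup.closure
      {c : A | ∃ x y, ∃ b ∈ PB, c = P.ipA y (P.lsmul ⟨b, NonUnitalStarAlgebra.mem_top⟩ x)},
      P.rsmul x ⟨c, NonUnitalStarAlgebra.mem_top⟩ ∈ P.symm.rightSpan PB from
    this p (P.coe_subset_closure_ipA_lsmul hPAmin hPBdense hp)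
  intro c hc
  induction hc using AddSubgroup.closure_induction with
  | mem c hc =>
    obtain ⟨z, y, b, hb, rfl⟩ := hc
    rw [Subtype.coe_eta, P.ip_compat, ← P.lsmul_mul]
    exact P.lsmul_mem_symm_rightSpan z (hPB b hb _).2
  | zero =>
    have := P.rsmul_zero x
    exact this ▸ zero_mem _
  | add c c' _ _ h h' =>
    have := P.add_rsmul x ⟨c, NonUnitalStarAlgebra.mem_top⟩ ⟨c', NonUnitalStarAlgebra.mem_top⟩
    exact this ▸ add_mem h h'
  | neg c _ h =>
    have := P.rsmul_neg x ⟨c, NonUnitalStarAlgebra.mem_top⟩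
    exact this ▸ neg_mem h

theorem rightSpan_eq [StarOrderedRing A] [StarOrderedRing B]
    (hPA : ∀ a ∈ PA, ∀ b : A, a * b ∈ PA ∧ b * a ∈ PA) (hPAdense : Dense (PA : Set A))
    (hPAmin : ∀ I : TwoSidedIdeal A, Dense (I : Set A) → (PA : Set A) ⊆ (I : Set A))
    (hPB : ∀ a ∈ PB, ∀ b : B, a * b ∈ PB ∧ b * a ∈ PB) (hPBdense : Dense (PB : Set B))
    (hPBmin : ∀ I : TwoSidedIdeal B, Dense (I : Set B) → (PB : Set B) ⊆ (I : Set B)) :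
    P.rightSpan PA = P.symm.rightSpan PB := by
  refine le_antisymm (P.rightSpan_le hPAmin hPB hPBdense) ?_
  have := P.symm.rightSpan_le hPBmin hPA hPAdense
  rwa [symm_symm] at this

theorem ipA_sum_sum {PB' : NonUnitalStarSubalgebra ℂ B} {PA' : NonUnitalStarSubalgebra ℂ A}
    (P : PreImprimBimodule PB' PA' X) {ι κ : Type} (s : Finset ι) (t : Finset κ)
    (x : ι → X) (y : κ → X) :
    P.ipA (∑ i ∈ s, x i) (∑ j ∈ t, y j) = ∑ i ∈ s, ∑ j ∈ t, P.ipA (x i) (y j) := by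
  change P.ipAHom _ _ = _
  simp only [map_sum, AddMonoidHom.finsetSum_apply]
  rw [Finset.sum_comm]
  rfl

/-- The Gram matrix of finitely many vectors of `X • PA` is of the form `C⋆ C` with `C` a matrix
over `PA`. -/
theorem exists_ipA_eq_sum_star_mul [StarOrderedRing A]
    (hPA : ∀ a ∈ PA, ∀ b : A, a * b ∈ PA ∧ b * a ∈ PA)
    {n : ℕ} (x : Fin n → X) (hx : ∀ i, x i ∈ P.rightSpan PA) :
    ∃ (m : ℕ) (c : Fin m → Fin n → PA),
      ∀ i j, (P.ipA (x i) (x j) : A) = ∑ k, star (c k i : A) * c k j := by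
  choose ι hι z p hp hxp using fun i => P.exists_eq_sum_rsmul_of_mem_rightSpan (hx i)
  let q : Fin n → (Σ i, ι i) → A := fun i k => if k.1 = i then p k.1 k.2 else 0
  have hq : ∀ i k, q i k ∈ PA := fun i k => by
    dsimp only [q]
    split_ifs
    · exact hp _ _
    · exact zero_mem _
  have hxq : ∀ i, x i = ∑ k : (Σ i, ι i), P.rsmul (z k.1 k.2) ⟨q i k, NonUnitalStarAlgebra.mem_top⟩ := fun i => by
    rw [Fintype.sum_sigma, Finset.sum_eq_single i]
    · simpa [q] using hxp i
    · intro j _ hj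
      refine Finset.sum_eq_zero fun k _ => ?_
      simp only [q, hj, if_false]
      exact P.rsmul_zero _
    · simp
  have hT : ∀ v w : (Σ i, ι i) → A,
      (P.ipA (∑ k, P.rsmul (z k.1 k.2) ⟨v k, NonUnitalStarAlgebra.mem_top⟩)
        (∑ k, P.rsmul (z k.1 k.2) ⟨w k, NonUnitalStarAlgebra.mem_top⟩) : A) =
      ∑ k, ∑ l, star (v k) * P.ipA (z k.1 k.2) (z l.1 l.2) * w l := fun v w => by
    rw [ipA_sum_sum]
    simp only [P.ipA_rsmul_rsmul]
    push_cast
    rfl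
  obtain ⟨m, S, hS⟩ := exists_eq_sum_star_mul_of_fintype
    (fun k l : (Σ i, ι i) => (P.ipA (z k.1 k.2) (z l.1 l.2) : A))
    (fun k l => congrArg Subtype.val (P.ipA_star _ _))
    (fun v => by rw [← hT]; exact P.posA _)
  refine ⟨m, fun k i => ⟨∑ l, S k l * q i l, sum_mem fun l _ => (hPA _ (hq i l) _).2⟩,
    fun i j => ?_⟩
  rw [hxq i, hxq j, hT]
  simp only [hS, star_sum, star_mul, Finset.mul_sum, Finset.sum_mul]
  rw [Finset.sum_comm_cycle]
  refine Finset.sum_congr rfl fun k _ => ?_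
  rw [Finset.sum_comm]
  refine Finset.sum_congr rfl fun l _ => Finset.sum_congr rfl fun l' _ => ?_
  simp only [mul_assoc]

end PreImprimBimodule

theorem StarRep.sum_inner_nonneg {A : Type} [NonUnitalRing A] [Module ℂ A] [StarRing A]
    (R : StarRep A) {m n : ℕ} (T : Fin n → Fin n → A) (c : Fin m → Fin n → A)
    (h : ∀ i j, T i j = ∑ k, star (c k i) * c k j) (φ : Fin n → R.carrier) :
    0 ≤ ∑ i, ∑ j, ⟪φ i, R.toFun (T i j) (φ j)⟫ := by
  let f : A →+ (R.carrier →ₗ[ℂ] R.carrier) := AddMonoidHom.mk' R.toFun R.map_add'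
  have hf : ∀ i j, ⟪φ i, R.toFun (T i j) (φ j)⟫ =
      ∑ k, ⟪R.toFun (c k i) (φ i), R.toFun (c k j) (φ j)⟫ := fun i j => by
    have h1 : R.toFun (T i j) = ∑ k, R.toFun (star (c k i) * c k j) := by
      rw [h]
      exact map_sum f _ _
    rw [h1, LinearMap.sum_apply, inner_sum]
    refine Finset.sum_congr rfl fun k _ => ?_
    rw [R.map_mul', LinearMap.comp_apply, ← R.star_rep']
  have h2 : ∑ i, ∑ j, ⟪φ i, R.toFun (T i j) (φ j)⟫ =
      ∑ k, ⟪∑ i, R.toFun (c k i) (φ i), ∑ i, R.toFun (c k i) (φ i)⟫ := by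
    simp only [hf, sum_inner, inner_sum]
    rw [Finset.sum_comm_cycle]
    refine Finset.sum_congr rfl fun k _ => Finset.sum_comm
  rw [h2]
  refine Finset.sum_nonneg fun k _ => ?_
  rw [inner_self_eq_norm_sq_to_K]
  have := Complex.zero_le_real.2 (sq_nonneg ‖∑ i, R.toFun (c k i) (φ i)‖)
  rw [Complex.ofReal_pow] at this
  exact this

theorem NonUnitalStarSubalgebra.span_eq_top_of_subset_closure {A : Type}
    [NonUnitalCStarAlgebra A] {PA : NonUnitalStarSubalgebra ℂ A} {s : Set PA}
    (h : (PA : Set A) ⊆ AddSubgroup.closure ((fun p : PA => (p : A)) '' s)) :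
    Submodule.span ℂ s = ⊤ := by
  refine eq_top_iff.2 fun p _ => ?_
  have h1 : AddSubgroup.closure ((fun p : PA => (p : A)) '' s) ≤
      (Submodule.span ℂ s).toAddSubgroup.map (NonUnitalSubringClass.subtype PA : PA →+ A) := by
    rw [AddSubgroup.closure_le]
    rintro _ ⟨q, hq, rfl⟩
    exact ⟨q, Submodule.subset_span hq, rfl⟩
  obtain ⟨q, hq, hqp⟩ := h1 (h p.2)
  exact (Subtype.ext hqp : q = p) ▸ hq

theorem dense_closure_of_dense_span {A : Type} [NonUnitalCStarAlgebra A] {s : Set A}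
    (hs : ∀ (c : ℂ), ∀ x ∈ s, c • x ∈ s) (h : Dense (Submodule.span ℂ s : Set A)) :
    Dense (AddSubgroup.closure s : Set A) := by
  refine h.mono fun x hx => ?_
  have hsmul : ∀ (c : ℂ) x, x ∈ AddSubgroup.closure s → c • x ∈ AddSubgroup.closure s := by
    intro c x hx
    induction hx using AddSubgroup.closure_induction with
    | mem x hx => exact AddSubgroup.subset_closure (hs c x hx)
    | zero => rw [smul_zero]; exact zero_mem _
    | add x y _ _ h h' => rw [smul_add]; exact add_mem h h'
    | neg x _ h => rw [smul_neg]; exact neg_mem h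
  induction hx using Submodule.span_induction with
  | mem x hx => exact AddSubgroup.subset_closure hx
  | zero => exact zero_mem _
  | add x y _ _ h h' => exact add_mem h h'
  | smul c x _ h => exact hsmul c x h

namespace ImprimBimodule

attribute [instance] ImprimBimodule.xgrp ImprimBimodule.xmod

variable {A B : Type}
  [NonUnitalCStarAlgebra A] [PartialOrder A] [StarOrderedRing A]
  [NonUnitalCStarAlgebra B] [PartialOrder B] [StarOrderedRing B]

/-- The additive data underlying an imprimitivity bimodule. -/
def toPre (I : ImprimBimodule B A) :
    PreImprimBimodule (⊤ : NonUnitalStarSubalgebra ℂ B) (⊤ : NonUnitalStarSubalgebra ℂ A) I.X where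
  lsmul b x := I.lsmul b x
  rsmul x a := I.rsmul x a
  lsmul_add b x y := I.lsmul_add _ x y
  rsmul_add x y a := I.rsmul_add x y _
  add_lsmul b b' x := I.add_lsmul _ _ x
  add_rsmul x a a' := I.add_rsmul x _ _
  lsmul_mul b b' x := I.lsmul_mul _ _ x
  rsmul_mul x a a' := I.rsmul_mul x _ _
  ipA x y := ⟨I.ipA x y, NonUnitalStarAlgebra.mem_top⟩
  ipB x y := ⟨I.ipB x y, NonUnitalStarAlgebra.mem_top⟩
  ipA_add x y z := Subtype.ext (I.ipA_add x y z)
  ipB_add x y z := Subtype.ext (I.ipB_add x y z)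
  ipA_rsmul x y a := Subtype.ext (I.ipA_rsmul x y a)
  ipB_lsmul b x y := Subtype.ext (I.ipB_lsmul b x y)
  ipA_star x y := Subtype.ext (I.ipA_star x y)
  ipB_star x y := Subtype.ext (I.ipB_star x y)
  ipA_compat b x y := Subtype.ext (I.ipA_compat b x y)
  ipB_compat x y a := Subtype.ext (I.ipB_compat x y a)
  ipA_smul_lsmul c b x y := Subtype.ext <| by
    change I.ipA x (I.lsmul (c • (b : B)) y) = c • I.ipA x (I.lsmul b y)
    rw [I.lsmul_smul, I.ipA_smul]
  ipB_smul_rsmul c a x y := Subtype.ext <| by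
    change I.ipB (I.rsmul x (c • (a : A))) y = c • I.ipB (I.rsmul x a) y
    rw [I.smul_rsmul, I.ipB_smul]
  ip_compat := I.ip_compat
  posA := I.posA
  posB := I.posB
  fullA := dense_closure_of_dense_span
    (by rintro c _ ⟨x, y, rfl⟩; exact ⟨x, c • y, (I.ipA_smul c x y).symm⟩) I.topFullA
  fullB := dense_closure_of_dense_span
    (by rintro c _ ⟨x, y, rfl⟩; exact ⟨c • x, y, (I.ipB_smul c x y).symm⟩) I.topFullB
  mul_memA _ _ := NonUnitalStarAlgebra.mem_top
  mul_memB _ _ := NonUnitalStarAlgebra.mem_top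

/-- The span of `X • PA` as a complex subspace. -/
def rightSpan (I : ImprimBimodule B A) (PA : NonUnitalStarSubalgebra ℂ A) : Submodule ℂ I.X :=
  { I.toPre.rightSpan PA with
    smul_mem' := fun c x hx => by
      change x ∈ I.toPre.rightSpan PA at hx
      change c • x ∈ I.toPre.rightSpan PA
      induction hx using AddSubgroup.closure_induction with
      | mem x hx =>
        obtain ⟨x, p, hp, rfl⟩ := hx
        exact AddSubgroup.subset_closure ⟨c • x, p, hp, (I.rsmul_smul c x p).symm⟩
      | zero => rw [smul_zero]; exact zero_mem _
      | add x y _ _ h h' => rw [smul_add]; exact add_mem h h'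
      | neg x _ h => rw [smul_neg]; exact neg_mem h }

theorem nonempty_equivBimodule (I : ImprimBimodule B A)
    (PA : NonUnitalStarSubalgebra ℂ A)
    (hPAideal : ∀ a ∈ PA, ∀ b : A, a * b ∈ PA ∧ b * a ∈ PA)
    (hPAdense : Dense (PA : Set A))
    (hPAmin : ∀ I : TwoSidedIdeal A, Dense (I : Set A) → (PA : Set A) ⊆ (I : Set A))
    (PB : NonUnitalStarSubalgebra ℂ B)
    (hPBideal : ∀ a ∈ PB, ∀ b : B, a * b ∈ PB ∧ b * a ∈ PB)
    (hPBdense : Dense (PB : Set B))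
    (hPBmin : ∀ I : TwoSidedIdeal B, Dense (I : Set B) → (PB : Set B) ⊆ (I : Set B)) :
    Nonempty (EquivBimodule PB PA) := by
  let P := I.toPre
  let Y := I.rightSpan PA
  have hY : ∀ x : Y, (x : I.X) ∈ P.rightSpan PA := fun x => x.2
  have hYeq : P.rightSpan PA = P.symm.rightSpan PB :=
    P.rightSpan_eq hPAideal hPAdense hPAmin hPBideal hPBdense hPBmin
  have hY' : ∀ x : Y, (x : I.X) ∈ P.symm.rightSpan PB := fun x => hYeq ▸ x.2
  have hipA : ∀ x y : Y, I.ipA x y ∈ PA := fun x y =>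
    P.ipA_mem_of_mem_rightSpan hPAideal x (hY y)
  have hipB : ∀ x y : Y, I.ipB x y ∈ PB := fun x y =>
    P.symm.ipA_mem_of_mem_rightSpan hPBideal x (hY' y)
  have hr : ∀ (x : Y) (a : PA), I.rsmul x a ∈ Y := fun x a =>
    P.rsmul_mem_of_mem_rightSpan hPAideal (hY x) ⟨a, NonUnitalStarAlgebra.mem_top⟩
  have hl : ∀ (b : PB) (x : Y), I.lsmul b x ∈ Y := fun b x => by
    have := P.symm.rsmul_mem_of_mem_rightSpan hPBideal (hY' x)
      ⟨star b, NonUnitalStarAlgebra.mem_top⟩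
    rw [← hYeq] at this
    have h2 : I.lsmul (star (star (b : B))) x ∈ P.rightSpan PA := this
    rwa [star_star] at h2
  have gramA : ∀ {n : ℕ} (x : Fin n → Y), ∃ (m : ℕ) (c : Fin m → Fin n → PA),
      ∀ i j, (⟨I.ipA (x i) (x j), hipA _ _⟩ : PA) = ∑ k, star (c k i) * c k j := by
    intro n x
    obtain ⟨m, c, hc⟩ := P.exists_ipA_eq_sum_star_mul hPAideal (fun i => (x i : I.X))
      (fun i => hY (x i))
    refine ⟨m, c, fun i j => Subtype.ext ?_⟩
    push_cast
    exact hc i j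
  have gramB : ∀ {n : ℕ} (x : Fin n → Y), ∃ (m : ℕ) (c : Fin m → Fin n → PB),
      ∀ i j, (⟨I.ipB (x i) (x j), hipB _ _⟩ : PB) = ∑ k, star (c k i) * c k j := by
    intro n x
    obtain ⟨m, c, hc⟩ := P.symm.exists_ipA_eq_sum_star_mul hPBideal (fun i => (x i : I.X))
      (fun i => hY' (x i))
    refine ⟨m, c, fun i j => Subtype.ext ?_⟩
    push_cast
    exact hc i j
  exact ⟨{
    X := Y
    lsmul := fun b x => ⟨I.lsmul b x, hl b x⟩
    rsmul := fun x a => ⟨I.rsmul x a, hr x a⟩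
    lsmul_add := fun b x y => Subtype.ext (I.lsmul_add _ _ _)
    add_lsmul := fun b b' x => Subtype.ext (I.add_lsmul _ _ _)
    lsmul_smul := fun c b x => Subtype.ext (I.lsmul_smul _ _ _)
    smul_lsmul := fun c b x => Subtype.ext (I.smul_lsmul _ _ _)
    lsmul_mul := fun b b' x => Subtype.ext (I.lsmul_mul _ _ _)
    rsmul_add := fun x y a => Subtype.ext (I.rsmul_add _ _ _)
    add_rsmul := fun x a a' => Subtype.ext (I.add_rsmul _ _ _)
    rsmul_smul := fun c x a => Subtype.ext (I.rsmul_smul _ _ _)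
    smul_rsmul := fun c x a => Subtype.ext (I.smul_rsmul _ _ _)
    rsmul_mul := fun x a a' => Subtype.ext (I.rsmul_mul _ _ _)
    lsmul_rsmul := fun b x a => Subtype.ext (I.lsmul_rsmul _ _ _)
    ipA := fun x y => ⟨I.ipA x y, hipA x y⟩
    ipA_add := fun x y z => Subtype.ext (I.ipA_add _ _ _)
    ipA_smul := fun c x y => Subtype.ext (I.ipA_smul _ _ _)
    ipA_rsmul := fun x y a => Subtype.ext (I.ipA_rsmul _ _ _)
    ipA_star := fun x y => Subtype.ext (I.ipA_star _ _)
    ipA_compat := fun b x y => Subtype.ext (I.ipA_compat _ _ _)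
    ipB := fun x y => ⟨I.ipB x y, hipB x y⟩
    ipB_add := fun x y z => Subtype.ext (I.ipB_add _ _ _)
    ipB_smul := fun c x y => Subtype.ext (I.ipB_smul _ _ _)
    ipB_lsmul := fun b x y => Subtype.ext (I.ipB_lsmul _ _ _)
    ipB_star := fun x y => Subtype.ext (I.ipB_star _ _)
    ipB_compat := fun x y a => Subtype.ext (I.ipB_compat _ _ _)
    ip_compat := fun x y z => Subtype.ext (I.ip_compat _ _ _)
    fullA := by
      refine NonUnitalStarSubalgebra.span_eq_top_of_subset_closure
        ((P.coe_subset_closure_ipA hPAdense hPAmin hPAideal).trans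
          (AddSubgroup.closure_mono ?_))
      rintro _ ⟨x, hx, y, hy, rfl⟩
      exact ⟨⟨_, hipA ⟨x, hx⟩ ⟨y, hy⟩⟩, ⟨⟨x, hx⟩, ⟨y, hy⟩, rfl⟩, rfl⟩
    fullB := by
      refine NonUnitalStarSubalgebra.span_eq_top_of_subset_closure
        ((P.symm.coe_subset_closure_ipA hPBdense hPBmin hPBideal).trans
          (AddSubgroup.closure_mono ?_))
      rintro _ ⟨x, hx, y, hy, rfl⟩
      rw [← hYeq] at hx hy
      exact ⟨⟨_, hipB ⟨x, hx⟩ ⟨y, hy⟩⟩, ⟨⟨x, hx⟩, ⟨y, hy⟩, rfl⟩, rfl⟩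
    posA := fun ω hω x => by
      obtain ⟨m, c, hc⟩ := gramA (n := 1) fun _ => x
      rw [hc 0 0, map_sum]
      exact Finset.sum_nonneg fun k _ => hω _
    posB := fun ω hω x => by
      obtain ⟨m, c, hc⟩ := gramB (n := 1) fun _ => x
      rw [hc 0 0, map_sum]
      exact Finset.sum_nonneg fun k _ => hω _
    propP := fun R n x φ => by
      obtain ⟨m, c, hc⟩ := gramA x
      exact R.sum_inner_nonneg _ c hc φ
    propQ := fun R n x φ => by
      obtain ⟨m, c, hc⟩ := gramB x
      exact R.sum_inner_nonneg _ c hc φ }⟩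

end ImprimBimodule

theorem exists_continuousMap_extension {G H G' H' K : Type} [SeminormedAddCommGroup G]
    [SeminormedAddCommGroup H] [SeminormedAddCommGroup G'] [SeminormedAddCommGroup H']
    [NormedAddCommGroup K] [CompleteSpace K] {e : G →+ G'} {f : H →+ H'}
    (he : IsDenseInducing e) (hf : IsDenseInducing f) (m : G → H → K)
    (add_left : ∀ x x' y, m (x + x') y = m x y + m x' y)
    (add_right : ∀ x y y', m x (y + y') = m x y + m x y')
    (bound : ∀ x y, ‖m x y‖ ≤ ‖x‖ * ‖y‖) :
    ∃ M : C(G' × H', K), ∀ x y, M (e x, f y) = m x y := by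
  let φ : G →+ H →+ K := AddMonoidHom.mk' (fun x => AddMonoidHom.mk' (m x) (add_right x))
    fun x x' => AddMonoidHom.ext (add_left x x')
  have hφ : Continuous fun p : G × H => φ p.1 p.2 := by
    refine continuous_iff_continuousAt.2 fun ⟨x₀, y₀⟩ => tendsto_iff_norm_sub_tendsto_zero.2 ?_
    have h0 : Filter.Tendsto
        (fun p : G × H => ‖p.1 - x₀‖ * ‖p.2‖ + ‖x₀‖ * ‖p.2 - y₀‖) (nhds (x₀, y₀)) (nhds 0) := by
      have : Continuous fun p : G × H => ‖p.1 - x₀‖ * ‖p.2‖ + ‖x₀‖ * ‖p.2 - y₀‖ := by fun_prop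
      simpa using this.tendsto (x₀, y₀)
    refine squeeze_zero (fun _ => norm_nonneg _) (fun p => ?_) h0
    have h1 : φ p.1 p.2 - φ x₀ y₀ = φ (p.1 - x₀) p.2 + φ x₀ (p.2 - y₀) := by simp
    change ‖φ p.1 p.2 - φ x₀ y₀‖ ≤ _
    rw [h1]
    exact (norm_add_le _ _).trans (add_le_add (bound _ _) (bound _ _))
  refine ⟨⟨_, IsDenseInducing.extend_Z_bilin he hf hφ⟩, fun x y => ?_⟩
  exact (he.prodMap hf).extend_eq hφ (x, y)

namespace PreImprimBimodule

variable {A B : Type}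
  [NonUnitalCStarAlgebra A] [PartialOrder A] [StarOrderedRing A]
  [NonUnitalCStarAlgebra B] [PartialOrder B] [StarOrderedRing B]
  {PB : NonUnitalStarSubalgebra ℂ B} {PA : NonUnitalStarSubalgebra ℂ A}
  {X : Type} [AddCommGroup X]

omit [StarOrderedRing B] in
theorem norm_ipA_le (P : PreImprimBimodule PB PA X) (x y : X) :
    ‖(P.ipA x y : A)‖ ≤ √‖(P.ipA x x : A)‖ * √‖(P.ipA y y : A)‖ := by
  rw [← Real.sqrt_mul (norm_nonneg _)]
  exact Real.le_sqrt_of_sq_le (P.norm_ipA_sq_le x y)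

theorem norm_ipB_le_sqrt_mul_sqrt (P : PreImprimBimodule PB PA X) (x y : X) :
    ‖(P.ipB x y : B)‖ ≤ √‖(P.ipA x x : A)‖ * √‖(P.ipA y y : A)‖ := by
  rw [← P.norm_ipB_eq, ← P.norm_ipB_eq]
  exact P.symm.norm_ipA_le x y

open UniformSpace in
/-- The completion of a pre-imprimitivity bimodule over dense ideals is an imprimitivity bimodule. -/
theorem nonempty_imprimBimodule {X : Type} [SeminormedAddCommGroup X] [NormedSpace ℂ X]
    (P : PreImprimBimodule PB PA X)
    (hPAdense : Dense (PA : Set A)) (hPBdense : Dense (PB : Set B))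
    (norm_def : ∀ x : X, ‖x‖ = √‖(P.ipA x x : A)‖)
    (lsmul_smul : ∀ (c : ℂ) (b : PB) (x : X), P.lsmul (c • b) x = c • P.lsmul b x)
    (smul_lsmul : ∀ (c : ℂ) (b : PB) (x : X), P.lsmul b (c • x) = c • P.lsmul b x)
    (rsmul_smul : ∀ (c : ℂ) (x : X) (a : PA), P.rsmul (c • x) a = c • P.rsmul x a)
    (smul_rsmul : ∀ (c : ℂ) (x : X) (a : PA), P.rsmul x (c • a) = c • P.rsmul x a)
    (lsmul_rsmul : ∀ (b : PB) (x : X) (a : PA), P.rsmul (P.lsmul b x) a = P.lsmul b (P.rsmul x a))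
    (ipA_smul : ∀ (c : ℂ) (x y : X), P.ipA x (c • y) = c • P.ipA x y)
    (ipB_smul : ∀ (c : ℂ) (x y : X), P.ipB (c • x) y = c • P.ipB x y) :
    Nonempty (ImprimBimodule B A) := by
  have norm_sq : ∀ x : X, ‖x‖ ^ 2 = ‖(P.ipA x x : A)‖ := fun x => by
    rw [norm_def, Real.sq_sqrt (norm_nonneg _)]
  have norm_ipA : ∀ x y : X, ‖(P.ipA x y : A)‖ ≤ ‖x‖ * ‖y‖ := fun x y => by
    rw [norm_def, norm_def]
    exact P.norm_ipA_le x y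
  have norm_ipB : ∀ x y : X, ‖(P.ipB x y : B)‖ ≤ ‖x‖ * ‖y‖ := fun x y => by
    rw [norm_def, norm_def]
    exact P.norm_ipB_le_sqrt_mul_sqrt x y
  let ι : X →+ Completion X := Completion.toCompl
  have hι : IsDenseInducing ι := Completion.isDenseInducing_coe
  have hA : IsDenseInducing (NonUnitalSubringClass.subtype PA : PA →+ A) :=
    hPAdense.isDenseInducing_val
  have hB : IsDenseInducing (NonUnitalSubringClass.subtype PB : PB →+ B) :=
    hPBdense.isDenseInducing_val
  obtain ⟨IA, hIA⟩ := exists_continuousMap_extension hι hι (fun x y => (P.ipA x y : A))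
    (fun x x' y => congrArg Subtype.val (P.ipA_add_left x x' y))
    (fun x y y' => congrArg Subtype.val (P.ipA_add x y y')) norm_ipA
  obtain ⟨IB, hIB⟩ := exists_continuousMap_extension hι hι (fun x y => (P.ipB x y : B))
    (fun x x' y => congrArg Subtype.val (P.ipB_add x x' y))
    (fun x y y' => congrArg Subtype.val (P.symm.ipA_add x y y')) norm_ipB
  obtain ⟨L, hL⟩ := exists_continuousMap_extension hB hι (fun b x => ι (P.lsmul b x))
    (fun b b' y => by rw [P.add_lsmul, map_add])
    (fun b x x' => by rw [P.lsmul_add, map_add])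
    (fun b x => by
      refine (Completion.norm_coe _).trans_le (le_of_sq_le_sq ?_ (by positivity))
      rw [mul_pow, norm_sq, norm_sq]
      exact P.norm_ipA_lsmul_le b x)
  obtain ⟨R, hR⟩ := exists_continuousMap_extension hι hA (fun x a => ι (P.rsmul x a))
    (fun x x' a => by rw [P.rsmul_add, map_add])
    (fun x a a' => by rw [P.add_rsmul, map_add])
    (fun x a => by
      refine (Completion.norm_coe _).trans_le (le_of_sq_le_sq ?_ (by positivity))
      rw [mul_pow, norm_sq, norm_sq, mul_comm]
      exact P.norm_ipA_rsmul_le x a)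
  have dA := hPAdense.denseRange_val
  have dB := hPBdense.denseRange_val
  have dX : DenseRange ι := hι.dense
  replace hL : ∀ (b : PB) x, L ((b : B), ι x) = ι (P.lsmul b x) := hL
  replace hR : ∀ x (a : PA), R (ι x, (a : A)) = ι (P.rsmul x a) := hR
  have norm_eq : ∀ x : Completion X, ‖x‖ = √‖IA (x, x)‖ := fun x => by
    refine dX.induction_on x (isClosed_eq (by fun_prop) (by fun_prop)) fun x => ?_
    rw [hIA]
    exact (Completion.norm_coe x).trans (norm_def x)
  obtain ⟨S, hS⟩ : ∃ S : ℂ → C(Completion X, Completion X), ∀ c x, c • x = S c x :=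
    ⟨fun c => ⟨_, continuous_const_smul c⟩, fun _ _ => rfl⟩
  have hιsmul : ∀ (c : ℂ) x, S c (ι x) = ι (c • x) := fun c x =>
    (hS c _).symm.trans (Completion.coe_smul c x).symm
  have hstarA : ∀ p : PA, star (p : A) = (star p : PA) := fun _ => rfl
  have hstarB : ∀ p : PB, star (p : B) = (star p : PB) := fun _ => rfl
  exact ⟨{
    X := Completion X
    xgrp := inferInstance
    xmod := inferInstance
    xcomplete := inferInstance
    lsmul := fun b x => L (b, x)
    rsmul := fun x a => R (x, a)
    lsmul_add := fun b x y => by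
      refine dB.induction_on b (isClosed_eq (by fun_prop) (by fun_prop)) fun b => ?_
      refine dX.induction_on x (isClosed_eq (by fun_prop) (by fun_prop)) fun x => ?_
      refine dX.induction_on y (isClosed_eq (by fun_prop) (by fun_prop)) fun y => ?_
      rw [← map_add, hL, hL, hL, ← map_add, P.lsmul_add]
    add_lsmul := fun b b' x => by
      refine dB.induction_on b (isClosed_eq (by fun_prop) (by fun_prop)) fun b => ?_
      refine dB.induction_on b' (isClosed_eq (by fun_prop) (by fun_prop)) fun b' => ?_
      refine dX.induction_on x (isClosed_eq (by fun_prop) (by fun_prop)) fun x => ?_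
      rw [← NonUnitalStarSubalgebra.coe_add, hL, hL, hL, ← map_add, P.add_lsmul]
    lsmul_smul := fun c b x => by
      simp only [hS]
      refine dB.induction_on b (isClosed_eq (by fun_prop) (by fun_prop)) fun b => ?_
      refine dX.induction_on x (isClosed_eq (by fun_prop) (by fun_prop)) fun x => ?_
      rw [← NonUnitalStarSubalgebra.coe_smul, hL, hL, hιsmul, lsmul_smul]
    smul_lsmul := fun c b x => by
      simp only [hS]
      refine dB.induction_on b (isClosed_eq (by fun_prop) (by fun_prop)) fun b => ?_
      refine dX.induction_on x (isClosed_eq (by fun_prop) (by fun_prop)) fun x => ?_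
      rw [hL, hιsmul, hιsmul, hL, smul_lsmul]
    lsmul_mul := fun b b' x => by
      refine dB.induction_on b (isClosed_eq (by fun_prop) (by fun_prop)) fun b => ?_
      refine dB.induction_on b' (isClosed_eq (by fun_prop) (by fun_prop)) fun b' => ?_
      refine dX.induction_on x (isClosed_eq (by fun_prop) (by fun_prop)) fun x => ?_
      rw [← NonUnitalStarSubalgebra.coe_mul, hL, hL, hL, P.lsmul_mul]
    rsmul_add := fun x y a => by
      refine dX.induction_on x (isClosed_eq (by fun_prop) (by fun_prop)) fun x => ?_
      refine dX.induction_on y (isClosed_eq (by fun_prop) (by fun_prop)) fun y => ?_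
      refine dA.induction_on a (isClosed_eq (by fun_prop) (by fun_prop)) fun a => ?_
      rw [← map_add, hR, hR, hR, ← map_add, P.rsmul_add]
    add_rsmul := fun x a a' => by
      refine dX.induction_on x (isClosed_eq (by fun_prop) (by fun_prop)) fun x => ?_
      refine dA.induction_on a (isClosed_eq (by fun_prop) (by fun_prop)) fun a => ?_
      refine dA.induction_on a' (isClosed_eq (by fun_prop) (by fun_prop)) fun a' => ?_
      rw [← NonUnitalStarSubalgebra.coe_add, hR, hR, hR, ← map_add, P.add_rsmul]
    rsmul_smul := fun c x a => by
      simp only [hS]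
      refine dX.induction_on x (isClosed_eq (by fun_prop) (by fun_prop)) fun x => ?_
      refine dA.induction_on a (isClosed_eq (by fun_prop) (by fun_prop)) fun a => ?_
      rw [hR, hιsmul, hιsmul, hR, rsmul_smul]
    smul_rsmul := fun c x a => by
      simp only [hS]
      refine dX.induction_on x (isClosed_eq (by fun_prop) (by fun_prop)) fun x => ?_
      refine dA.induction_on a (isClosed_eq (by fun_prop) (by fun_prop)) fun a => ?_
      rw [← NonUnitalStarSubalgebra.coe_smul, hR, hR, hιsmul, smul_rsmul]
    rsmul_mul := fun x a a' => by
      refine dX.induction_on x (isClosed_eq (by fun_prop) (by fun_prop)) fun x => ?_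
      refine dA.induction_on a (isClosed_eq (by fun_prop) (by fun_prop)) fun a => ?_
      refine dA.induction_on a' (isClosed_eq (by fun_prop) (by fun_prop)) fun a' => ?_
      rw [← NonUnitalStarSubalgebra.coe_mul, hR, hR, hR, P.rsmul_mul]
    lsmul_rsmul := fun b x a => by
      refine dB.induction_on b (isClosed_eq (by fun_prop) (by fun_prop)) fun b => ?_
      refine dX.induction_on x (isClosed_eq (by fun_prop) (by fun_prop)) fun x => ?_
      refine dA.induction_on a (isClosed_eq (by fun_prop) (by fun_prop)) fun a => ?_
      rw [hR, hL, hL, hR, lsmul_rsmul]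
    ipA := fun x y => IA (x, y)
    ipA_add := fun x y z => by
      refine dX.induction_on x (isClosed_eq (by fun_prop) (by fun_prop)) fun x => ?_
      refine dX.induction_on y (isClosed_eq (by fun_prop) (by fun_prop)) fun y => ?_
      refine dX.induction_on z (isClosed_eq (by fun_prop) (by fun_prop)) fun z => ?_
      rw [← map_add, hIA, hIA, hIA, P.ipA_add, NonUnitalStarSubalgebra.coe_add]
    ipA_smul := fun c x y => by
      simp only [hS]
      refine dX.induction_on x (isClosed_eq (by fun_prop) (by fun_prop)) fun x => ?_
      refine dX.induction_on y (isClosed_eq (by fun_prop) (by fun_prop)) fun y => ?_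
      rw [hιsmul, hIA, hIA, ipA_smul, NonUnitalStarSubalgebra.coe_smul]
    ipA_rsmul := fun x y a => by
      refine dX.induction_on x (isClosed_eq (by fun_prop) (by fun_prop)) fun x => ?_
      refine dX.induction_on y (isClosed_eq (by fun_prop) (by fun_prop)) fun y => ?_
      refine dA.induction_on a (isClosed_eq (by fun_prop) (by fun_prop)) fun a => ?_
      rw [hR, hIA, hIA, P.ipA_rsmul, NonUnitalStarSubalgebra.coe_mul]
    ipA_star := fun x y => by
      refine dX.induction_on x (isClosed_eq (by fun_prop) (by fun_prop)) fun x => ?_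
      refine dX.induction_on y (isClosed_eq (by fun_prop) (by fun_prop)) fun y => ?_
      rw [hIA, hIA, P.ipA_star, hstarA]
    ipA_compat := fun b x y => by
      refine dB.induction_on b (isClosed_eq (by fun_prop) (by fun_prop)) fun b => ?_
      refine dX.induction_on x (isClosed_eq (by fun_prop) (by fun_prop)) fun x => ?_
      refine dX.induction_on y (isClosed_eq (by fun_prop) (by fun_prop)) fun y => ?_
      rw [hstarB, hL, hL, hIA, hIA, P.ipA_compat]
    ipB := fun x y => IB (x, y)
    ipB_add := fun x y z => by
      refine dX.induction_on x (isClosed_eq (by fun_prop) (by fun_prop)) fun x => ?_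
      refine dX.induction_on y (isClosed_eq (by fun_prop) (by fun_prop)) fun y => ?_
      refine dX.induction_on z (isClosed_eq (by fun_prop) (by fun_prop)) fun z => ?_
      rw [← map_add, hIB, hIB, hIB, P.ipB_add, NonUnitalStarSubalgebra.coe_add]
    ipB_smul := fun c x y => by
      simp only [hS]
      refine dX.induction_on x (isClosed_eq (by fun_prop) (by fun_prop)) fun x => ?_
      refine dX.induction_on y (isClosed_eq (by fun_prop) (by fun_prop)) fun y => ?_
      rw [hιsmul, hIB, hIB, ipB_smul, NonUnitalStarSubalgebra.coe_smul]
    ipB_lsmul := fun b x y => by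
      refine dB.induction_on b (isClosed_eq (by fun_prop) (by fun_prop)) fun b => ?_
      refine dX.induction_on x (isClosed_eq (by fun_prop) (by fun_prop)) fun x => ?_
      refine dX.induction_on y (isClosed_eq (by fun_prop) (by fun_prop)) fun y => ?_
      rw [hL, hIB, hIB, P.ipB_lsmul, NonUnitalStarSubalgebra.coe_mul]
    ipB_star := fun x y => by
      refine dX.induction_on x (isClosed_eq (by fun_prop) (by fun_prop)) fun x => ?_
      refine dX.induction_on y (isClosed_eq (by fun_prop) (by fun_prop)) fun y => ?_
      rw [hIB, hIB, P.ipB_star, hstarB]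
    ipB_compat := fun x y a => by
      refine dX.induction_on x (isClosed_eq (by fun_prop) (by fun_prop)) fun x => ?_
      refine dX.induction_on y (isClosed_eq (by fun_prop) (by fun_prop)) fun y => ?_
      refine dA.induction_on a (isClosed_eq (by fun_prop) (by fun_prop)) fun a => ?_
      rw [hstarA, hR, hR, hIB, hIB, P.ipB_compat]
    ip_compat := fun x y z => by
      refine dX.induction_on x (isClosed_eq (by fun_prop) (by fun_prop)) fun x => ?_
      refine dX.induction_on y (isClosed_eq (by fun_prop) (by fun_prop)) fun y => ?_
      refine dX.induction_on z (isClosed_eq (by fun_prop) (by fun_prop)) fun z => ?_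
      rw [hIA, hIB, hR, hL, P.ip_compat]
    posA := fun x => by
      refine dX.induction_on x (isClosed_le (by fun_prop) (by fun_prop)) fun x => ?_
      rw [hIA]
      exact P.posA x
    posB := fun x => by
      refine dX.induction_on x (isClosed_le (by fun_prop) (by fun_prop)) fun x => ?_
      rw [hIB]
      exact P.posB x
    defA := fun x hx => by
      rw [← norm_eq_zero, norm_eq, hx, norm_zero, Real.sqrt_zero]
    topFullA := (P.fullA.mono ((AddSubgroup.closure_le _).2 (by
      rintro _ ⟨x, y, rfl⟩
      exact Submodule.subset_span ⟨ι x, ι y, (hIA x y).symm⟩) :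
        _ ≤ (Submodule.span ℂ _).toAddSubgroup))
    topFullB := (P.fullB.mono ((AddSubgroup.closure_le _).2 (by
      rintro _ ⟨x, y, rfl⟩
      exact Submodule.subset_span ⟨ι x, ι y, (hIB x y).symm⟩) :
        _ ≤ (Submodule.span ℂ _).toAddSubgroup))
    norm_eq := norm_eq }⟩


end PreImprimBimodule

theorem NonUnitalStarSubalgebra.subset_span_of_span_eq_top {A : Type} [NonUnitalCStarAlgebra A]
    {PA : NonUnitalStarSubalgebra ℂ A} {s : Set PA} {t : Set A} (hst : ∀ p ∈ s, (p : A) ∈ t)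
    (h : Submodule.span ℂ s = ⊤) : (PA : Set A) ⊆ Submodule.span ℂ t := by
  have h1 : Submodule.span ℂ s ≤ (Submodule.span ℂ t).comap (SMulMemClass.subtype PA) :=
    Submodule.span_le.2 fun p hp => Submodule.subset_span (hst p hp)
  exact fun p hp => h1 (h ▸ Submodule.mem_top : (⟨p, hp⟩ : PA) ∈ Submodule.span ℂ s)

namespace EquivBimodule

attribute [instance] EquivBimodule.xgrp EquivBimodule.xmod

variable {A B : Type}
  [NonUnitalCStarAlgebra A] [PartialOrder A] [StarOrderedRing A]
  [NonUnitalCStarAlgebra B] [PartialOrder B] [StarOrderedRing B]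
  {PA : NonUnitalStarSubalgebra ℂ A} {PB : NonUnitalStarSubalgebra ℂ B}

/-- The additive data underlying an equivalence bimodule of dense ideals. -/
def toPre (E : EquivBimodule PB PA)
    (hPAideal : ∀ a ∈ PA, ∀ b : A, a * b ∈ PA ∧ b * a ∈ PA) (hPAdense : Dense (PA : Set A))
    (hPBideal : ∀ a ∈ PB, ∀ b : B, a * b ∈ PB ∧ b * a ∈ PB) (hPBdense : Dense (PB : Set B)) :
    PreImprimBimodule PB PA E.X where
  __ := E
  ipA_smul_lsmul c b x y := by rw [E.lsmul_smul, E.ipA_smul]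
  ipB_smul_rsmul c a x y := by rw [E.smul_rsmul, E.ipB_smul]
  posA x := nonneg_of_forall_positive_functional (congrArg Subtype.val (E.ipA_star x x)).symm
    fun ω hω => E.posA (ω ∘ₗ PA.toSubmodule.subtype) (fun a => hω a) x
  posB x := nonneg_of_forall_positive_functional (congrArg Subtype.val (E.ipB_star x x)).symm
    fun ω hω => E.posB (ω ∘ₗ PB.toSubmodule.subtype) (fun a => hω a) x
  fullA := dense_closure_of_dense_span
    (by rintro c _ ⟨x, y, rfl⟩; exact ⟨x, c • y, congrArg Subtype.val (E.ipA_smul c x y).symm⟩)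
    (hPAdense.mono (NonUnitalStarSubalgebra.subset_span_of_span_eq_top
      (by rintro _ ⟨x, y, rfl⟩; exact ⟨x, y, rfl⟩) E.fullA))
  fullB := dense_closure_of_dense_span
    (by rintro c _ ⟨x, y, rfl⟩; exact ⟨c • x, y, congrArg Subtype.val (E.ipB_smul c x y).symm⟩)
    (hPBdense.mono (NonUnitalStarSubalgebra.subset_span_of_span_eq_top
      (by rintro _ ⟨x, y, rfl⟩; exact ⟨x, y, rfl⟩) E.fullB))
  mul_memA a p := (hPAideal p p.2 a).2
  mul_memB b p := (hPBideal p p.2 b).2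

theorem nonempty_imprimBimodule (E : EquivBimodule PB PA)
    (hPAideal : ∀ a ∈ PA, ∀ b : A, a * b ∈ PA ∧ b * a ∈ PA) (hPAdense : Dense (PA : Set A))
    (hPBideal : ∀ a ∈ PB, ∀ b : B, a * b ∈ PB ∧ b * a ∈ PB) (hPBdense : Dense (PB : Set B)) :
    Nonempty (ImprimBimodule B A) := by
  let P := E.toPre hPAideal hPAdense hPBideal hPBdense
  let : Norm E.X := ⟨fun x => √‖(E.ipA x x : A)‖⟩
  have norm_def : ∀ x : E.X, ‖x‖ = √‖(E.ipA x x : A)‖ := fun _ => rfl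
  have norm_sq : ∀ x : E.X, ‖x‖ ^ 2 = ‖(E.ipA x x : A)‖ := fun x => Real.sq_sqrt (norm_nonneg _)
  have norm_ipA : ∀ x y : E.X, ‖(E.ipA x y : A)‖ ≤ ‖x‖ * ‖y‖ := P.norm_ipA_le
  have addl : ∀ x y z : E.X, E.ipA (x + y) z = E.ipA x z + E.ipA y z := P.ipA_add_left
  have core : SeminormedSpace.Core ℂ E.X :=
    { norm_nonneg := fun x => Real.sqrt_nonneg _
      norm_smul := fun c x => by
        rw [norm_def, E.ipA_smul, E.ipA_star, E.ipA_smul, star_smul, ← E.ipA_star,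
          NonUnitalStarSubalgebra.coe_smul, NonUnitalStarSubalgebra.coe_smul, norm_smul, norm_smul,
          norm_star, ← mul_assoc, Real.sqrt_mul (by positivity),
          Real.sqrt_mul_self (norm_nonneg c), norm_def]
      norm_triangle := fun x y => by
        refine le_of_sq_le_sq ?_ (add_nonneg (Real.sqrt_nonneg _) (Real.sqrt_nonneg _))
        have h : (E.ipA (x + y) (x + y) : A) =
            (E.ipA x x + E.ipA x y) + (E.ipA y x + E.ipA y y) := by
          rw [E.ipA_add, addl, addl]
          push_cast
          abel
        rw [norm_sq, h]
        refine (norm_add_le _ _).trans ((add_le_add (norm_add_le _ _) (norm_add_le _ _)).trans ?_)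
        have h1 := norm_ipA x x
        have h2 := norm_ipA x y
        have h3 := norm_ipA y x
        have h4 := norm_ipA y y
        nlinarith }
  let : SeminormedAddCommGroup E.X := SeminormedAddCommGroup.ofCore core
  let : NormedSpace ℂ E.X := { norm_smul_le := fun c x => (core.norm_smul c x).le }
  exact P.nonempty_imprimBimodule hPAdense hPBdense norm_def E.lsmul_smul E.smul_lsmul
    E.rsmul_smul E.smul_rsmul E.lsmul_rsmul E.ipA_smul E.ipB_smul

end EquivBimodule

/-- Two (possibly non-unital) C*-algebras `A` and `B` are strongly Morita
equivalent if and only if their Pedersen ideals `P_A` and `P_B` are formally Morita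
equivalent as *-algebras over `ℂ`.  (In particular, two unital C*-algebras are strongly
Morita equivalent iff they are formally Morita equivalent.) -/
theorem stmt3 {A B : Type}
    [NonUnitalCStarAlgebra A] [PartialOrder A] [StarOrderedRing A]
    [NonUnitalCStarAlgebra B] [PartialOrder B] [StarOrderedRing B]
    (PA : NonUnitalStarSubalgebra ℂ A)
    (hPAideal : ∀ a ∈ PA, ∀ b : A, a * b ∈ PA ∧ b * a ∈ PA)
    (hPAdense : Dense (PA : Set A))
    (hPAmin : ∀ I : TwoSidedIdeal A, Dense (I : Set A) → (PA : Set A) ⊆ (I : Set A))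
    (PB : NonUnitalStarSubalgebra ℂ B)
    (hPBideal : ∀ a ∈ PB, ∀ b : B, a * b ∈ PB ∧ b * a ∈ PB)
    (hPBdense : Dense (PB : Set B))
    (hPBmin : ∀ I : TwoSidedIdeal B, Dense (I : Set B) → (PB : Set B) ⊆ (I : Set B)) :
    Nonempty (ImprimBimodule B A) ↔ Nonempty (EquivBimodule (↥PB) (↥PA)) := by
  exact ⟨fun ⟨I⟩ => I.nonempty_equivBimodule PA hPAideal hPAdense hPAmin PB hPBideal hPBdense hPBmin,
    fun ⟨E⟩ => E.nonempty_imprimBimodule hPAideal hPAdense hPBideal hPBdense⟩
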